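/- Let 1 < p < ∞. If 𝓜 is a nonzero prime ideal in the ring M^p which is not a dense subset of the metric space (M^p, ρ_p), then there exists λ in the open unit disk 𝔻 such that 𝓜 = 𝓜_λ, where 𝓜_λ = {f ∈ M^p : f(λ) = 0}. -/

import Mathlib

open MeasureTheory Filter Set
open scoped ENNReal Topology Real NNReal

noncomputable section

/-- The open unit disk in the complex plane. -/
def unitDisk : Set ℂ := Metric.ball 0 1

/-- The point `r·e^{iθ}`. -/
def circlePt (r θ : ℝ) : ℂ := (r : ℂ) * Complex.exp (θ * Complex.I)

/-- The maximal radial function `Mf(θ) = sup_{0 ≤ r < 1} |f(r e^{iθ})|`, valued in `ℝ≥0∞`. -/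
def maxRad (f : ℂ → ℂ) (θ : ℝ) : ℝ≥0∞ :=
  ⨆ r ∈ Set.Ico (0 : ℝ) 1, (‖f (circlePt r θ)‖₊ : ℝ≥0∞)

/-- `log⁺` on `ℝ≥0∞`. -/
def elogPlus (x : ℝ≥0∞) : ℝ≥0∞ :=
  if x = ∞ then ∞ else ENNReal.ofReal (Real.log x.toReal)

/-- `x ↦ log (1 + x)` on `ℝ≥0∞`. -/
def elog1p (x : ℝ≥0∞) : ℝ≥0∞ :=
  if x = ∞ then ∞ else ENNReal.ofReal (Real.log (1 + x.toReal))

/-- The radial boundary value `f*(e^{iθ}) = lim_{r→1⁻} f(r e^{iθ})`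
(a junk value is returned where the limit does not exist). -/
def radialLimit (f : ℂ → ℂ) (θ : ℝ) : ℂ :=
  limUnder (nhdsWithin (1 : ℝ) (Set.Iio 1)) fun r : ℝ => f (circlePt r θ)

/-- The class `M^p`: holomorphic functions on the unit disk with
`∫₀^{2π} (log⁺ Mf(θ))^p dθ/2π < ∞`. -/
def MpClass (p : ℝ) : Set (ℂ → ℂ) :=
  {f | DifferentiableOn ℂ f unitDisk ∧
    (∫⁻ θ in Set.Ioc 0 (2 * π), elogPlus (maxRad f θ) ^ p) / ENNReal.ofReal (2 * π) < ∞}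

/-- The metric `ρ_p` on `M^p`. -/
def rhoMetric (p : ℝ) (f g : ℂ → ℂ) : ℝ≥0∞ :=
  ((∫⁻ θ in Set.Ioc 0 (2 * π), elog1p (maxRad (f - g) θ) ^ p) /
    ENNReal.ofReal (2 * π)) ^ (1 / p)

/-- The Privalov class `N^p`: holomorphic functions on the unit disk with
`sup_{0≤r<1} ∫₀^{2π} (log⁺|f(re^{iθ})|)^p dθ/2π < ∞`. -/
def NpClass (p : ℝ) : Set (ℂ → ℂ) :=
  {f | DifferentiableOn ℂ f unitDisk ∧
    (⨆ r ∈ Set.Ico (0 : ℝ) 1,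
      (∫⁻ θ in Set.Ioc 0 (2 * π),
        ENNReal.ofReal (Real.log ‖f (circlePt r θ)‖) ^ p) / ENNReal.ofReal (2 * π)) < ∞}

/-- The metric `d_p` on `N^p`, defined via boundary values. -/
def dMetric (p : ℝ) (f g : ℂ → ℂ) : ℝ≥0∞ :=
  ((∫⁻ θ in Set.Ioc 0 (2 * π),
      ENNReal.ofReal (Real.log (1 + ‖radialLimit f θ - radialLimit g θ‖)) ^ p) /
    ENNReal.ofReal (2 * π)) ^ (1 / p)

/-- The Hardy space `H^p`. -/
def HpClass (p : ℝ) : Set (ℂ → ℂ) :=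
  {f | DifferentiableOn ℂ f unitDisk ∧
    (⨆ r ∈ Set.Ico (0 : ℝ) 1,
      (∫⁻ θ in Set.Ioc 0 (2 * π), (‖f (circlePt r θ)‖₊ : ℝ≥0∞) ^ p) /
        ENNReal.ofReal (2 * π)) < ∞}

/-- The Smirnov class `N⁺`. -/
def SmirnovClass : Set (ℂ → ℂ) :=
  {f | DifferentiableOn ℂ f unitDisk ∧
    (∫⁻ θ in Set.Ioc 0 (2 * π), ENNReal.ofReal (Real.log ‖radialLimit f θ‖)) /
      ENNReal.ofReal (2 * π) < ∞ ∧
    Tendsto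
      (fun r : ℝ => (∫⁻ θ in Set.Ioc 0 (2 * π),
        ENNReal.ofReal (Real.log ‖f (circlePt r θ)‖)) / ENNReal.ofReal (2 * π))
      (nhdsWithin (1 : ℝ) (Set.Iio 1))
      (nhds ((∫⁻ θ in Set.Ioc 0 (2 * π),
        ENNReal.ofReal (Real.log ‖radialLimit f θ‖)) / ENNReal.ofReal (2 * π)))}

/-- The normalized Blaschke factor `(|a|/a)·(a − z)/(1 − conj a · z)`. -/
def blaschkeFactor (a z : ℂ) : ℂ :=
  ((‖a‖ : ℂ) / a) * ((a - z) / (1 - (starRingEnd ℂ) a * z))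

/-- `B` is a (finite or infinite) Blaschke product on the unit disk. -/
def IsBlaschkeProduct (B : ℂ → ℂ) : Prop :=
  ∃ m : ℕ,
    (∃ n : ℕ, ∃ a : ℕ → ℂ, (∀ k < n, a k ∈ unitDisk ∧ a k ≠ 0) ∧
      ∀ z ∈ unitDisk, B z = z ^ m * ∏ k ∈ Finset.range n, blaschkeFactor (a k) z) ∨
    (∃ a : ℕ → ℂ, (∀ k, a k ∈ unitDisk ∧ a k ≠ 0) ∧ (Summable fun k => 1 - ‖a k‖) ∧
      ∀ z ∈ unitDisk, B z = z ^ m * ∏' k, blaschkeFactor (a k) z)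

/-- `I` is an ideal of the ring `M^p`. -/
structure IsIdealIn (p : ℝ) (I : Set (ℂ → ℂ)) : Prop where
  subset : I ⊆ MpClass p
  zero_mem : (0 : ℂ → ℂ) ∈ I
  add_mem : ∀ f ∈ I, ∀ g ∈ I, f + g ∈ I
  neg_mem : ∀ f ∈ I, -f ∈ I
  mul_mem : ∀ f ∈ MpClass p, ∀ g ∈ I, f * g ∈ I

/-- `I` is a prime ideal of the ring `M^p`: an ideal such that whenever a product of two
elements of `M^p` lies in `I`, one of the factors lies in `I`. -/
def IsPrimeIdealIn (p : ℝ) (I : Set (ℂ → ℂ)) : Prop :=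
  IsIdealIn p I ∧ ∀ f ∈ MpClass p, ∀ g ∈ MpClass p, f * g ∈ I → f ∈ I ∨ g ∈ I

/-- `I` is a dense subset of the metric space `(M^p, ρ_p)`. -/
def IsDenseIn (p : ℝ) (I : Set (ℂ → ℂ)) : Prop :=
  ∀ f ∈ MpClass p, ∀ ε : ℝ≥0∞, 0 < ε → ∃ g ∈ I, rhoMetric p f g < ε

/-- `I` is an ideal of the ring `N^p`. -/
structure IsIdealInNp (p : ℝ) (I : Set (ℂ → ℂ)) : Prop where
  subset : I ⊆ NpClass p
  zero_mem : (0 : ℂ → ℂ) ∈ I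
  add_mem : ∀ f ∈ I, ∀ g ∈ I, f + g ∈ I
  neg_mem : ∀ f ∈ I, -f ∈ I
  mul_mem : ∀ f ∈ NpClass p, ∀ g ∈ I, f * g ∈ I

/-- `I` is a prime ideal of the ring `N^p`. -/
def IsPrimeIdealInNp (p : ℝ) (I : Set (ℂ → ℂ)) : Prop :=
  IsIdealInNp p I ∧ ∀ f ∈ NpClass p, ∀ g ∈ NpClass p, f * g ∈ I → f ∈ I ∨ g ∈ I

/-- `I` is a dense subset of the metric space `(N^p, d_p)`. -/
def IsDenseInNp (p : ℝ) (I : Set (ℂ → ℂ)) : Prop :=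
  ∀ f ∈ NpClass p, ∀ ε : ℝ≥0∞, 0 < ε → ∃ g ∈ I, dMetric p f g < ε


/-! ### Basic facts about the circle points, `maxRad` and the logarithms -/

lemma circlePt_norm {r : ℝ} (hr : 0 ≤ r) (θ : ℝ) : ‖circlePt r θ‖ = r := by
  rw [circlePt, norm_mul, Complex.norm_exp_ofReal_mul_I, mul_one, Complex.norm_real,
    Real.norm_of_nonneg hr]

lemma circlePt_mem {r : ℝ} (hr : r ∈ Set.Ico (0 : ℝ) 1) (θ : ℝ) : circlePt r θ ∈ unitDisk := by
  rw [unitDisk, mem_ball_zero_iff, circlePt_norm hr.1]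
  exact hr.2

lemma continuous_circlePt (r : ℝ) : Continuous (circlePt r) := by
  unfold circlePt
  fun_prop

lemma isOpen_unitDisk : IsOpen unitDisk := Metric.isOpen_ball

lemma zero_mem_unitDisk : (0 : ℂ) ∈ unitDisk := by simp [unitDisk]

lemma measurable_maxRad {f : ℂ → ℂ} (hf : DifferentiableOn ℂ f unitDisk) :
    Measurable (maxRad f) := by
  apply LowerSemicontinuous.measurable
  apply lowerSemicontinuous_biSup
  intro r hr
  apply Continuous.lowerSemicontinuous
  have h : Continuous fun θ => f (circlePt r θ) :=
    hf.continuousOn.comp_continuous (continuous_circlePt r) (fun θ => circlePt_mem hr θ)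
  exact ENNReal.continuous_coe.comp h.nnnorm

lemma maxRad_congr {f g : ℂ → ℂ} (h : EqOn f g unitDisk) : maxRad f = maxRad g := by
  funext θ
  unfold maxRad
  refine iSup_congr fun r => iSup_congr fun hr => ?_
  rw [h (circlePt_mem hr θ)]

lemma le_maxRad (f : ℂ → ℂ) {r : ℝ} (hr : r ∈ Set.Ico (0 : ℝ) 1) (θ : ℝ) :
    (‖f (circlePt r θ)‖₊ : ℝ≥0∞) ≤ maxRad f θ :=
  le_iSup₂ (f := fun r (_ : r ∈ Set.Ico (0 : ℝ) 1) => (‖f (circlePt r θ)‖₊ : ℝ≥0∞)) r hr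

lemma maxRad_le_of_bound {f : ℂ → ℂ} {C : ℝ} (h : ∀ z ∈ unitDisk, ‖f z‖ ≤ C) (θ : ℝ) :
    maxRad f θ ≤ ENNReal.ofReal C := by
  refine iSup₂_le fun r hr => ?_
  rw [← enorm_eq_nnnorm, ← ofReal_norm]
  exact ENNReal.ofReal_le_ofReal (h _ (circlePt_mem hr θ))

lemma maxRad_mul_le (f g : ℂ → ℂ) (θ : ℝ) : maxRad (f * g) θ ≤ maxRad f θ * maxRad g θ := by
  refine iSup₂_le fun r hr => ?_
  rw [Pi.mul_apply, nnnorm_mul, ENNReal.coe_mul]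
  exact mul_le_mul' (le_maxRad f hr θ) (le_maxRad g hr θ)

lemma elogPlus_mono : Monotone elogPlus := by
  intro x y hxy
  unfold elogPlus
  split_ifs with hx hy hy
  · exact le_rfl
  · exact absurd (top_le_iff.1 (hx ▸ hxy)) hy
  · exact le_top
  · rcases eq_or_ne x 0 with rfl | h0
    · simp
    · apply ENNReal.ofReal_le_ofReal
      exact Real.log_le_log (ENNReal.toReal_pos h0 hx) (ENNReal.toReal_mono hy hxy)

lemma elog1p_mono : Monotone elog1p := by
  intro x y hxy
  unfold elog1p
  split_ifs with hx hy hy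
  · exact le_rfl
  · exact absurd (top_le_iff.1 (hx ▸ hxy)) hy
  · exact le_top
  · apply ENNReal.ofReal_le_ofReal
    have := ENNReal.toReal_mono hy hxy
    have := ENNReal.toReal_nonneg (a := x)
    exact Real.log_le_log (by positivity) (by linarith)

lemma elog1p_le (x : ℝ≥0∞) : elog1p x ≤ x := by
  unfold elog1p
  split_ifs with hx
  · rw [hx]
  · conv_rhs => rw [← ENNReal.ofReal_toReal hx]
    apply ENNReal.ofReal_le_ofReal
    have := ENNReal.toReal_nonneg (a := x)
    have := Real.log_le_sub_one_of_pos (show 0 < 1 + x.toReal by positivity)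
    linarith

lemma log_affine_le {C : ℝ} (hC : 1 ≤ C) {x : ℝ} (hx : 0 ≤ x) :
    Real.log (C * (1 + x)) ≤ Real.log (2 * C) + max (Real.log x) 0 := by
  rcases le_or_gt x 1 with h | h
  · have : Real.log (C * (1 + x)) ≤ Real.log (2 * C) :=
      Real.log_le_log (by positivity) (by nlinarith)
    linarith [le_max_right (Real.log x) 0]
  · have : Real.log (C * (1 + x)) ≤ Real.log (2 * C * x) :=
      Real.log_le_log (by positivity) (by nlinarith)
    have e := Real.log_mul (x := 2 * C) (y := x) (by positivity) (by positivity)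
    rw [e] at this
    linarith [le_max_left (Real.log x) 0]

lemma ofReal_log_affine_le {C : ℝ} (hC : 1 ≤ C) {x : ℝ} (hx : 0 ≤ x) :
    ENNReal.ofReal (Real.log (C * (1 + x))) ≤
      ENNReal.ofReal (Real.log (2 * C)) + ENNReal.ofReal (Real.log x) := by
  refine (ENNReal.ofReal_le_ofReal (log_affine_le hC hx)).trans ?_
  refine ENNReal.ofReal_add_le.trans ?_
  refine add_le_add_right ?_ _
  rcases le_total (Real.log x) 0 with h | h <;> simp [h]

lemma elogPlus_affine_le {C : ℝ} (hC : 1 ≤ C) (x : ℝ≥0∞) :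
    elogPlus (ENNReal.ofReal C * (1 + x)) ≤ ENNReal.ofReal (Real.log (2 * C)) + elogPlus x := by
  rcases eq_or_ne x ∞ with rfl | hx
  · simp [elogPlus]
  · have h1 : ENNReal.ofReal C * (1 + x) ≠ ∞ := by finiteness
    unfold elogPlus
    rw [if_neg h1, if_neg hx]
    have : (ENNReal.ofReal C * (1 + x)).toReal = C * (1 + x.toReal) := by
      rw [ENNReal.toReal_mul, ENNReal.toReal_add (by simp) hx,
        ENNReal.toReal_ofReal (by linarith)]
      simp
    rw [this]
    exact ofReal_log_affine_le hC ENNReal.toReal_nonneg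

lemma elog1p_two_mul_le (x : ℝ≥0∞) :
    elog1p (2 * x) ≤ ENNReal.ofReal (Real.log 4) + elogPlus x := by
  rcases eq_or_ne x ∞ with rfl | hx
  · simp [elogPlus]
  · have h1 : 2 * x ≠ ∞ := by finiteness
    unfold elog1p elogPlus
    rw [if_neg h1, if_neg hx]
    have h2 := ofReal_log_affine_le (C := 2) (by norm_num) (ENNReal.toReal_nonneg (a := x))
    norm_num at h2
    refine le_trans (ENNReal.ofReal_le_ofReal ?_) h2
    have := ENNReal.toReal_nonneg (a := x)
    rw [ENNReal.toReal_mul]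
    apply Real.log_le_log
    · simp; positivity
    · simp; linarith

lemma lintegral_Ioc_const_ne_top (c : ℝ≥0∞) (hc : c ≠ ∞) :
    ∫⁻ _ in Set.Ioc 0 (2 * π), c ≠ ∞ := by
  rw [setLIntegral_const]
  exact ENNReal.mul_ne_top hc measure_Ioc_lt_top.ne

lemma lintegral_ne_top_of_mem {p : ℝ} {f : ℂ → ℂ} (hf : f ∈ MpClass p) :
    ∫⁻ θ in Set.Ioc 0 (2 * π), elogPlus (maxRad f θ) ^ p ≠ ∞ := by
  intro h
  have := hf.2
  rw [h, ENNReal.top_div_of_ne_top ENNReal.ofReal_ne_top] at this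
  exact lt_irrefl _ this

lemma mem_of_lintegral {p : ℝ} {f : ℂ → ℂ} (hd : DifferentiableOn ℂ f unitDisk)
    (h : ∫⁻ θ in Set.Ioc 0 (2 * π), elogPlus (maxRad f θ) ^ p ≠ ∞) : f ∈ MpClass p := by
  refine ⟨hd, ENNReal.div_lt_top h ?_⟩
  simp [Real.pi_pos]

lemma lintegral_const_add_rpow_ne_top {p : ℝ} (hp : 1 < p) {φ : ℝ → ℝ≥0∞} {c : ℝ≥0∞}
    (hc : c ≠ ∞) (h : ∫⁻ θ in Set.Ioc 0 (2 * π), φ θ ^ p ≠ ∞) :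
    ∫⁻ θ in Set.Ioc 0 (2 * π), (c + φ θ) ^ p ≠ ∞ := by
  have h1 : ∫⁻ θ in Set.Ioc 0 (2 * π), (c + φ θ) ^ p ≤
      ∫⁻ θ in Set.Ioc 0 (2 * π), 2 ^ (p - 1) * (c ^ p + φ θ ^ p) :=
    lintegral_mono fun θ => ENNReal.rpow_add_le_mul_rpow_add_rpow _ _ hp.le
  refine ne_top_of_le_ne_top ?_ h1
  have h2 : (2 : ℝ≥0∞) ^ (p - 1) ≠ ∞ := ENNReal.rpow_ne_top_of_nonneg (by linarith) (by simp)
  have h3 : c ^ p ≠ ∞ := ENNReal.rpow_ne_top_of_nonneg (by linarith) hc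
  rw [lintegral_const_mul' _ _ h2, lintegral_add_left measurable_const]
  exact ENNReal.mul_ne_top h2 (ENNReal.add_ne_top.2 ⟨lintegral_Ioc_const_ne_top _ h3, h⟩)

/-- Membership in `M^p` from an affine bound by another member. -/
lemma mem_of_affine_bound {p : ℝ} (hp : 1 < p) {f g : ℂ → ℂ} (hf : f ∈ MpClass p)
    (hg : DifferentiableOn ℂ g unitDisk) {C : ℝ} (hC : 1 ≤ C)
    (h : ∀ z ∈ unitDisk, ‖g z‖ ≤ C * (1 + ‖f z‖)) : g ∈ MpClass p := by
  apply mem_of_lintegral hg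
  have h1 := lintegral_const_add_rpow_ne_top hp
    (c := ENNReal.ofReal (Real.log (2 * C))) (by simp) (lintegral_ne_top_of_mem hf)
  refine ne_top_of_le_ne_top h1 (lintegral_mono fun θ => ?_)
  refine ENNReal.rpow_le_rpow ?_ (by linarith)
  refine le_trans (elogPlus_mono ?_) (elogPlus_affine_le hC _)
  refine iSup₂_le fun r hr => ?_
  refine le_trans ?_ (mul_le_mul_right (add_le_add_right (le_maxRad f hr θ) 1) _)
  have h2 := ENNReal.ofReal_le_ofReal (h _ (circlePt_mem hr θ))
  rw [ENNReal.ofReal_mul (by linarith), ENNReal.ofReal_add (by simp) (by simp)] at h2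
  simpa [ofReal_norm, enorm_eq_nnnorm] using h2

lemma zero_mem_Mp {p : ℝ} (hp : 1 < p) : (0 : ℂ → ℂ) ∈ MpClass p := by
  apply mem_of_lintegral (show DifferentiableOn ℂ (0 : ℂ → ℂ) unitDisk from differentiableOn_const 0)
  have : maxRad (0 : ℂ → ℂ) = 0 := by
    funext θ
    simp [maxRad]
  rw [this]
  have h2 : elogPlus 0 = 0 := by simp [elogPlus]
  simp [h2, ENNReal.zero_rpow_of_pos (show 0 < p by linarith)]

lemma mem_of_bounded {p : ℝ} (hp : 1 < p) {g : ℂ → ℂ}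
    (hg : DifferentiableOn ℂ g unitDisk) {C : ℝ}
    (h : ∀ z ∈ unitDisk, ‖g z‖ ≤ C) : g ∈ MpClass p := by
  refine mem_of_affine_bound hp (zero_mem_Mp hp) hg (C := max C 1) (le_max_right _ _) ?_
  intro z hz
  simpa using Or.inl (h z hz)

lemma mem_congr {p : ℝ} {f g : ℂ → ℂ} (hf : f ∈ MpClass p) (h : EqOn f g unitDisk) :
    g ∈ MpClass p := by
  refine ⟨hf.1.congr fun z hz => (h hz).symm, ?_⟩
  rw [← maxRad_congr h]
  exact hf.2

/-- Dividing out a point: the difference quotient of a member is a member. -/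
lemma mem_dslope {p : ℝ} (hp : 1 < p) {f : ℂ → ℂ} (hf : f ∈ MpClass p) {w : ℂ}
    (hw : w ∈ unitDisk) : dslope f w ∈ MpClass p := by
  have hd : DifferentiableOn ℂ (dslope f w) unitDisk :=
    (Complex.differentiableOn_dslope (isOpen_unitDisk.mem_nhds hw)).2 hf.1
  have hw' : ‖w‖ < 1 := by simpa [unitDisk] using hw
  set ρ : ℝ := (1 + ‖w‖) / 2 with hρ
  have hsub : Metric.closedBall (0 : ℂ) ρ ⊆ unitDisk := by
    intro z hz
    rw [mem_closedBall_zero_iff] at hz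
    rw [unitDisk, mem_ball_zero_iff]
    linarith
  obtain ⟨K, hK⟩ := (isCompact_closedBall (0 : ℂ) ρ).exists_bound_of_continuousOn
    (hd.continuousOn.mono hsub)
  set δ : ℝ := (1 - ‖w‖) / 2 with hδ
  have hδ0 : 0 < δ := by linarith
  refine mem_of_affine_bound hp hf hd (C := max 1 (max K (max 1 ‖f w‖ / δ))) (le_max_left _ _) ?_
  intro z hz
  by_cases hzρ : ‖z‖ ≤ ρ
  · have h1 := hK z (by simpa using hzρ)
    have h2 : K ≤ max 1 (max K (max 1 ‖f w‖ / δ)) :=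
      (le_max_left _ _).trans (le_max_right _ _)
    have h3 : 1 ≤ max 1 (max K (max 1 ‖f w‖ / δ)) := le_max_left _ _
    nlinarith [norm_nonneg (f z)]
  · push Not at hzρ
    have hzw : z ≠ w := by
      rintro rfl
      linarith
    have hdist : δ ≤ ‖z - w‖ := by
      have := norm_sub_norm_le z w
      linarith
    rw [dslope_of_ne _ hzw, slope_def_field, norm_div]
    have h1 : ‖f z - f w‖ / ‖z - w‖ ≤ (‖f z‖ + ‖f w‖) / δ := by
      gcongr
      exact norm_sub_le _ _
    refine h1.trans ?_
    have h2 : max 1 ‖f w‖ / δ ≤ max 1 (max K (max 1 ‖f w‖ / δ)) :=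
      (le_max_right _ _).trans (le_max_right _ _)
    refine le_trans ?_ (mul_le_mul_of_nonneg_right h2 (by positivity))
    rw [div_mul_eq_mul_div]
    gcongr
    have h3 : 1 ≤ max 1 ‖f w‖ := le_max_left _ _
    have h4 : ‖f w‖ ≤ max 1 ‖f w‖ := le_max_right _ _
    nlinarith [norm_nonneg (f z)]


/-! ### A Hardy and Littlewood type covering estimate and the weak type bound -/

lemma hardyLittlewood_weak (u : ℝ → ℝ≥0∞) (hu : ∫⁻ s, u s ≠ ∞) {κ : ℝ≥0∞} (hκ : κ ≠ 0)
    (hκ' : κ ≠ ∞) :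
    κ * volume {θ : ℝ | ∃ R : ℝ, 0 < R ∧
      κ * ENNReal.ofReal R < ∫⁻ s in Metric.closedBall θ R, u s} ≤ 10 * ∫⁻ s, u s := by
  set E : Set ℝ := {θ : ℝ | ∃ R : ℝ, 0 < R ∧
      κ * ENNReal.ofReal R < ∫⁻ s in Metric.closedBall θ R, u s} with hE
  have hch : ∀ θ : ℝ, ∃ R : ℝ, θ ∈ E → (0 < R ∧
      κ * ENNReal.ofReal R < ∫⁻ s in Metric.closedBall θ R, u s) := by
    intro θ
    by_cases h : θ ∈ E
    · obtain ⟨R, hR⟩ := h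
      exact ⟨R, fun _ => hR⟩
    · exact ⟨0, fun h' => absurd h' h⟩
  choose r hr using hch
  have hbd : ∀ a ∈ E, r a ≤ ((∫⁻ s, u s) / κ).toReal := by
    intro a ha
    have h1 := (hr a ha).2.le.trans (setLIntegral_le_lintegral _ _)
    have h2 : ENNReal.ofReal (r a) ≤ (∫⁻ s, u s) / κ := by
      rw [ENNReal.le_div_iff_mul_le (Or.inl hκ) (Or.inl hκ'), mul_comm]
      exact h1
    exact (ENNReal.ofReal_le_iff_le_toReal (ENNReal.div_ne_top hu hκ)).1 h2
  obtain ⟨v, hvE, hdisj, hcov⟩ :=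
    Vitali.exists_disjoint_subfamily_covering_enlargement_closedBall E (fun x : ℝ => x) r _ hbd 5
      (by norm_num)
  have hcount : v.Countable := by
    apply hdisj.countable_of_nonempty_interior
    intro i hi
    refine ⟨i, ?_⟩
    rw [mem_interior_iff_mem_nhds]
    exact Metric.closedBall_mem_nhds _ (hr i (hvE hi)).1
  have hsub : E ⊆ ⋃ b ∈ v, Metric.closedBall b (5 * r b) := by
    intro a ha
    obtain ⟨b, hb, hab⟩ := hcov a ha
    exact mem_iUnion₂.2 ⟨b, hb, hab (Metric.mem_closedBall_self (hr a ha).1.le)⟩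
  calc κ * volume E ≤ κ * ∑' b : v, volume (Metric.closedBall (b : ℝ) (5 * r b)) := by
        gcongr
        exact (measure_mono hsub).trans (measure_biUnion_le _ hcount _)
    _ = ∑' b : v, κ * volume (Metric.closedBall (b : ℝ) (5 * r b)) := ENNReal.tsum_mul_left.symm
    _ ≤ ∑' b : v, 10 * ∫⁻ s in Metric.closedBall (b : ℝ) (r b), u s := by
        refine ENNReal.tsum_le_tsum fun b => ?_
        have h1 := (hr b (hvE b.2)).2.le
        rw [Real.volume_closedBall]
        calc κ * ENNReal.ofReal (2 * (5 * r b)) = 10 * (κ * ENNReal.ofReal (r b)) := by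
              rw [show 2 * (5 * r b) = 10 * r b by ring, ENNReal.ofReal_mul (by norm_num)]
              norm_num
              ring
          _ ≤ _ := by gcongr
    _ = 10 * ∑' b : v, ∫⁻ s in Metric.closedBall (b : ℝ) (r b), u s := ENNReal.tsum_mul_left
    _ = 10 * ∫⁻ s in ⋃ b ∈ v, Metric.closedBall (b : ℝ) (r b), u s := by
        rw [lintegral_biUnion hcount (fun i _ => Metric.isClosed_closedBall.measurableSet) hdisj]
    _ ≤ _ := mul_le_mul_right (setLIntegral_le_lintegral _ _) _

lemma circlePt_eq_circleMap (r θ : ℝ) : circlePt r θ = circleMap 0 r θ := by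
  simp [circlePt, circleMap]

/-- Pointwise bound of the Poisson kernel. -/
lemma poissonKernel_dyadic {ρ r θ s : ℝ} (hρ : 1 / 2 ≤ ρ) (hρ1 : ρ < 1) (hr : 0 ≤ r)
    (hrρ : r < ρ) (hs : |s - θ| ≤ π) :
    ∃ k : ℕ, |s - θ| ≤ 2 ^ k * (ρ - r) ∧
      poissonKernel 0 (circlePt r θ) (circleMap 0 ρ s) ≤ 32 * π ^ 2 / (4 ^ k * (ρ - r)) := by
  set δ := ρ - r with hδ
  have hδ0 : 0 < δ := by linarith
  have hπ := Real.pi_pos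
  have hπ3 := Real.pi_gt_three
  rw [← circlePt_eq_circleMap]
  set d := ‖circlePt ρ s - circlePt r θ‖ with hd
  have hP : poissonKernel 0 (circlePt r θ) (circlePt ρ s) = (ρ ^ 2 - r ^ 2) / d ^ 2 := by
    rw [poissonKernel_def]
    simp only [sub_zero]
    rw [circlePt_norm hr, circlePt_norm (by linarith)]
  have hdδ : δ ≤ d := by
    have := norm_sub_norm_le (circlePt ρ s) (circlePt r θ)
    rwa [circlePt_norm hr, circlePt_norm (by linarith)] at this
  have hdx : |s - θ| ≤ 2 * π * d := by
    have h1 : ‖circlePt ρ s - circlePt ρ θ‖ ≤ d + δ := by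
      calc ‖circlePt ρ s - circlePt ρ θ‖
          = ‖(circlePt ρ s - circlePt r θ) - (circlePt ρ θ - circlePt r θ)‖ := by congr 1; ring
        _ ≤ d + ‖circlePt ρ θ - circlePt r θ‖ := norm_sub_le _ _
        _ = d + δ := by
          congr 1
          have : circlePt ρ θ - circlePt r θ = circlePt δ θ := by
            simp [circlePt, hδ]
            ring
          rw [this, circlePt_norm hδ0.le]
    have h2 : ‖circlePt ρ s - circlePt ρ θ‖ = ρ * |2 * Real.sin ((s - θ) / 2)| := by
      have : circlePt ρ s - circlePt ρ θ
          = circlePt ρ θ * (Complex.exp (Complex.I * ((s - θ : ℝ) : ℂ)) - 1) := by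
        simp only [circlePt]
        rw [mul_sub, mul_assoc, ← Complex.exp_add]
        push_cast
        ring_nf
      rw [this, norm_mul, circlePt_norm (by linarith), Complex.norm_exp_I_mul_ofReal_sub_one,
        Real.norm_eq_abs]
    have h3 : 2 / π * |(s - θ) / 2| ≤ |Real.sin ((s - θ) / 2)| := by
      apply Real.mul_abs_le_abs_sin
      rw [abs_div, abs_of_pos (show (0 : ℝ) < 2 by norm_num)]
      linarith
    rw [h2, abs_mul, abs_of_pos (show (0 : ℝ) < 2 by norm_num)] at h1
    rw [abs_div, abs_of_pos (show (0 : ℝ) < 2 by norm_num)] at h3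
    have h4 : 2 / π * (|s - θ| / 2) = |s - θ| / π := by ring
    rw [h4, div_le_iff₀ hπ] at h3
    have h5 : |Real.sin ((s - θ) / 2)| ≤ 2 * d := by
      nlinarith [abs_nonneg (Real.sin ((s - θ) / 2))]
    nlinarith
  have hd0 : 0 < d := by linarith
  rw [hP]
  have hnum : ρ ^ 2 - r ^ 2 ≤ 2 * δ := by nlinarith
  rcases le_or_gt (|s - θ|) δ with hx | hx
  · refine ⟨0, by simpa using hx, ?_⟩
    rw [div_le_div_iff₀ (by positivity) (by positivity)]
    have h1 : δ ^ 2 ≤ d ^ 2 := by gcongr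
    have h2 : (ρ ^ 2 - r ^ 2) * δ ≤ 2 * δ * δ := by gcongr
    have h3 : 2 * d ^ 2 ≤ 32 * π ^ 2 * d ^ 2 := by
      gcongr
      nlinarith
    nlinarith
  · obtain ⟨k, hk1, hk2⟩ := exists_nat_pow_near (x := |s - θ| / δ) (y := 2)
      ((one_le_div hδ0).2 hx.le) (by norm_num)
    refine ⟨k + 1, ((div_lt_iff₀ hδ0).1 hk2).le, ?_⟩
    rw [le_div_iff₀ hδ0] at hk1
    rw [div_le_div_iff₀ (by positivity) (by positivity)]
    have h1 : (2 ^ k * δ) ^ 2 ≤ (2 * π * d) ^ 2 :=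
      pow_le_pow_left₀ (by positivity) (by linarith) 2
    have h4 : (4 : ℝ) ^ k = (2 ^ k) ^ 2 := by
      rw [← pow_mul, mul_comm, pow_mul]; norm_num
    have h2 : (ρ ^ 2 - r ^ 2) * (4 ^ (k + 1) * δ) ≤ 2 * δ * (4 ^ (k + 1) * δ) := by gcongr
    refine h2.trans ?_
    rw [pow_succ, h4]
    nlinarith

lemma norm_le_lintegral_poisson {F : ℂ → ℂ} (hF : DifferentiableOn ℂ F unitDisk) {ρ : ℝ}
    (hρ0 : 0 < ρ) (hρ1 : ρ < 1) {w : ℂ} (hw : ‖w‖ < ρ) (η : ℝ) :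
    ENNReal.ofReal (2 * π) * ‖F w‖ₑ ≤ ∫⁻ s in Set.Ioc (η - π) (η + π),
      ENNReal.ofReal (poissonKernel 0 w (circleMap 0 ρ s)) * ‖F (circleMap 0 ρ s)‖ₑ := by
  have hcl : DiffContOnCl ℂ F (Metric.ball 0 ρ) := by
    apply DifferentiableOn.diffContOnCl
    rw [closure_ball _ hρ0.ne']
    exact hF.mono (Metric.closedBall_subset_ball hρ1)
  have h := hcl.circleAverage_poissonKernel_smul (w := w) (by simpa using hw)
  rw [Real.circleAverage_eq_integral_add (η - π),
    intervalIntegral.integral_comp_add_right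
      (fun s => (poissonKernel 0 w • F) (circleMap 0 ρ s))] at h
  rw [← h, enorm_smul]
  have hπ := Real.pi_pos
  have h1 : ‖(2 * π)⁻¹‖ₑ = ENNReal.ofReal ((2 * π)⁻¹) := by
    rw [Real.enorm_eq_ofReal (by positivity)]
  rw [h1, ← mul_assoc, ← ENNReal.ofReal_mul (by positivity),
    mul_inv_cancel₀ (by positivity), ENNReal.ofReal_one, one_mul,
    intervalIntegral.integral_of_le (by linarith)]
  rw [show 0 + (η - π) = η - π by ring, show 2 * π + (η - π) = η + π by ring]
  refine (enorm_integral_le_lintegral_enorm _).trans ?_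
  refine lintegral_mono fun s => ?_
  simp only [Pi.smul_apply', enorm_smul]
  gcongr
  rw [Real.enorm_eq_ofReal]
  rw [poissonKernel_def]
  apply div_nonneg _ (by positivity)
  have : ‖circleMap 0 ρ s - 0‖ = ρ := by simp [abs_of_pos hρ0]
  rw [this, sub_zero]
  nlinarith [norm_nonneg w]

lemma poisson_le_of_maximal {F : ℂ → ℂ} (hF : DifferentiableOn ℂ F unitDisk) {ρ r θ : ℝ}
    (hρ : 1 / 2 ≤ ρ) (hρ1 : ρ < 1) (hr : 0 ≤ r) (hrρ : r < ρ) (hθ : θ ∈ Set.Ioc 0 (2 * π))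
    {κ : ℝ}
    (hκ : ∀ R : ℝ, 0 < R → ∫⁻ s in Metric.closedBall θ R,
      (Set.Icc (-π) (3 * π)).indicator (fun s => ‖F (circleMap 0 ρ s)‖ₑ) s ≤
      ENNReal.ofReal κ * ENNReal.ofReal R) :
    ENNReal.ofReal (2 * π) * ‖F (circlePt r θ)‖ₑ ≤ ENNReal.ofReal (64 * π ^ 2) *
      ENNReal.ofReal κ := by
  have hπ := Real.pi_pos
  set δ := ρ - r with hδ
  have hδ0 : 0 < δ := by linarith
  set u : ℝ → ℝ≥0∞ := (Set.Icc (-π) (3 * π)).indicator (fun s => ‖F (circleMap 0 ρ s)‖ₑ) with hu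
  have hmeas : Measurable u := by
    apply Measurable.indicator _ measurableSet_Icc
    have : Continuous fun s => F (circleMap 0 ρ s) := by
      apply hF.continuousOn.comp_continuous (continuous_circleMap 0 ρ)
      intro s
      rw [← circlePt_eq_circleMap]
      exact circlePt_mem ⟨by linarith, hρ1⟩ s
    exact this.enorm.measurable
  refine (norm_le_lintegral_poisson hF (by linarith) hρ1
    (by rwa [circlePt_norm hr]) θ).trans ?_
  calc _ ≤ ∫⁻ s in Set.Ioc (θ - π) (θ + π), ∑' k : ℕ,
        ENNReal.ofReal (32 * π ^ 2 / (4 ^ k * δ)) *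
          (Metric.closedBall θ (2 ^ k * δ)).indicator u s := by
        refine setLIntegral_mono' measurableSet_Ioc fun s hs => ?_
        obtain ⟨k, hk1, hk2⟩ := poissonKernel_dyadic (θ := θ) (s := s) hρ hρ1 hr hrρ
          (by rw [abs_le]; constructor <;> linarith [hs.1, hs.2])
        refine le_trans ?_ (ENNReal.le_tsum k)
        have hus : u s = ‖F (circleMap 0 ρ s)‖ₑ := by
          rw [hu, indicator_of_mem]
          constructor <;> linarith [hs.1, hs.2, hθ.1, hθ.2]
        rw [indicator_of_mem (by simpa [Real.dist_eq] using hk1), hus]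
        gcongr
    _ ≤ ∫⁻ s, ∑' k : ℕ, ENNReal.ofReal (32 * π ^ 2 / (4 ^ k * δ)) *
          (Metric.closedBall θ (2 ^ k * δ)).indicator u s := setLIntegral_le_lintegral _ _
    _ = ∑' k : ℕ, ENNReal.ofReal (32 * π ^ 2 / (4 ^ k * δ)) *
          ∫⁻ s in Metric.closedBall θ (2 ^ k * δ), u s := by
        rw [lintegral_tsum]
        · refine tsum_congr fun k => ?_
          rw [lintegral_const_mul' _ _ ENNReal.ofReal_ne_top,
            lintegral_indicator Metric.isClosed_closedBall.measurableSet]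
        · intro k
          exact ((hmeas.indicator Metric.isClosed_closedBall.measurableSet).const_mul _).aemeasurable
    _ ≤ ∑' k : ℕ, ENNReal.ofReal ((32 * π ^ 2) * (1 / 2) ^ k) * ENNReal.ofReal κ := by
        refine ENNReal.tsum_le_tsum fun k => ?_
        have h1 := hκ (2 ^ k * δ) (by positivity)
        refine (mul_le_mul_right h1 _).trans ?_
        rw [mul_comm (ENNReal.ofReal κ), ← mul_assoc, ← ENNReal.ofReal_mul (by positivity)]
        refine mul_le_mul_left (ENNReal.ofReal_le_ofReal (le_of_eq ?_)) _
        have h4 : (4 : ℝ) ^ k = 2 ^ k * 2 ^ k := by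
          rw [← mul_pow]; norm_num
        rw [h4, one_div, inv_pow]
        field_simp
    _ = _ := by
        rw [ENNReal.tsum_mul_right]
        congr 1
        rw [← ENNReal.ofReal_tsum_of_nonneg (fun k => by positivity)
          (summable_geometric_two.mul_left _), tsum_mul_left, tsum_geometric_two]
        congr 1
        ring

lemma lintegral_two_periods {F : ℂ → ℂ} (hF : DifferentiableOn ℂ F unitDisk) {ρ ε : ℝ}
    (hρ : 0 < ρ) (hρ1 : ρ < 1) (hε : Real.circleAverage (fun z => ‖F z‖) 0 ρ ≤ ε) :
    ∫⁻ s, (Set.Icc (-π) (3 * π)).indicator (fun s => ‖F (circleMap 0 ρ s)‖ₑ) s ≤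
      ENNReal.ofReal (4 * π * ε) := by
  have hπ := Real.pi_pos
  have hc : Continuous fun s => F (circleMap 0 ρ s) := by
    apply hF.continuousOn.comp_continuous (continuous_circleMap 0 ρ)
    intro s
    rw [← circlePt_eq_circleMap]
    exact circlePt_mem ⟨by linarith, hρ1⟩ s
  have hper : Function.Periodic (fun s => ‖F (circleMap 0 ρ s)‖) (2 * π) := by
    intro s
    simp only [periodic_circleMap 0 ρ s]
  rw [lintegral_indicator measurableSet_Icc]
  rw [Real.circleAverage_def, smul_eq_mul] at hε
  have hi : Integrable (fun s => F (circleMap 0 ρ s)) (volume.restrict (Icc (-π) (3 * π))) :=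
    hc.integrableOn_Icc
  rw [← ofReal_integral_norm_eq_lintegral_enorm hi]
  apply ENNReal.ofReal_le_ofReal
  rw [integral_Icc_eq_integral_Ioc, ← intervalIntegral.integral_of_le (by linarith)]
  have h1 := hper.intervalIntegral_add_eq (-π) 0
  have h2 := hper.intervalIntegral_add_eq π 0
  rw [show -π + 2 * π = π by ring] at h1
  rw [show π + 2 * π = 3 * π by ring] at h2
  rw [zero_add] at h1 h2
  rw [← intervalIntegral.integral_add_adjacent_intervals (b := π)
    (hc.norm.intervalIntegrable _ _) (hc.norm.intervalIntegrable _ _), h1, h2]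
  rw [inv_mul_le_iff₀ (by positivity)] at hε
  linarith

/-- Weak type estimate for the maximal radial function. -/
lemma weak_type {F : ℂ → ℂ} (hF : DifferentiableOn ℂ F unitDisk) {ε t : ℝ} (ht : 0 < t)
    (hε : ∀ ρ ∈ Set.Ioo (0 : ℝ) 1, Real.circleAverage (fun z => ‖F z‖) 0 ρ ≤ ε) :
    volume (Set.Ioc 0 (2 * π) ∩ {θ | ENNReal.ofReal t < maxRad F θ}) ≤
      ENNReal.ofReal (1280 * π ^ 2 * ε / t) := by
  have hπ := Real.pi_pos
  set A : ℝ → Set ℝ := fun ρ => {θ | θ ∈ Set.Ioc 0 (2 * π) ∧ ∃ r, 0 ≤ r ∧ r < ρ ∧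
    ENNReal.ofReal t < ‖F (circlePt r θ)‖ₑ} with hA
  have hAmono : ∀ ρ ρ', ρ ≤ ρ' → A ρ ⊆ A ρ' := by
    rintro ρ ρ' h θ ⟨h1, r, h2, h3, h4⟩
    exact ⟨h1, r, h2, h3.trans_le h, h4⟩
  have hAle : ∀ ρ, 1 / 2 ≤ ρ → ρ < 1 → volume (A ρ) ≤ ENNReal.ofReal (1280 * π ^ 2 * ε / t) := by
    intro ρ h1 h2
    set κ : ℝ := t / (32 * π) with hκ
    have hκ0 : 0 < κ := by positivity
    set u : ℝ → ℝ≥0∞ := (Set.Icc (-π) (3 * π)).indicator (fun s => ‖F (circleMap 0 ρ s)‖ₑ) with hu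
    have hub : ∫⁻ s, u s ≤ ENNReal.ofReal (4 * π * ε) :=
      lintegral_two_periods hF (by linarith) h2 (hε ρ ⟨by linarith, h2⟩)
    have hHL := hardyLittlewood_weak u (ne_top_of_le_ne_top ENNReal.ofReal_ne_top hub)
      (κ := ENNReal.ofReal κ) (by simpa using hκ0) ENNReal.ofReal_ne_top
    have hsub : A ρ ⊆ {θ : ℝ | ∃ R : ℝ, 0 < R ∧
        ENNReal.ofReal κ * ENNReal.ofReal R < ∫⁻ s in Metric.closedBall θ R, u s} := by
      rintro θ ⟨hθ, r, hr0, hr1, hr2⟩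
      by_contra hcon
      have hcon' : ∀ R : ℝ, 0 < R → ∫⁻ s in Metric.closedBall θ R, u s ≤
          ENNReal.ofReal κ * ENNReal.ofReal R := by
        intro R hR
        by_contra h
        exact hcon ⟨R, hR, not_le.1 h⟩
      have h3 := poisson_le_of_maximal hF h1 h2 hr0 hr1 hθ hcon'
      have h4 : ENNReal.ofReal (64 * π ^ 2) * ENNReal.ofReal κ =
          ENNReal.ofReal (2 * π) * ENNReal.ofReal t := by
        rw [← ENNReal.ofReal_mul (by positivity), ← ENNReal.ofReal_mul (by positivity), hκ]
        congr 1
        field_simp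
        ring
      rw [h4, ENNReal.mul_le_mul_iff_right (by simpa using hπ) ENNReal.ofReal_ne_top] at h3
      exact absurd h3 (not_le.2 hr2)
    have h5 : ENNReal.ofReal κ * volume (A ρ) ≤ 10 * ENNReal.ofReal (4 * π * ε) :=
      (mul_le_mul_right (measure_mono hsub) _).trans (hHL.trans (mul_le_mul_right hub _))
    have h6 : (10 : ℝ≥0∞) * ENNReal.ofReal (4 * π * ε) =
        ENNReal.ofReal κ * ENNReal.ofReal (1280 * π ^ 2 * ε / t) := by
      rw [← ENNReal.ofReal_mul hκ0.le, show (10 : ℝ≥0∞) = ENNReal.ofReal 10 by norm_num,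
        ← ENNReal.ofReal_mul (by norm_num), hκ]
      congr 1
      field_simp
      ring
    rwa [h6, ENNReal.mul_le_mul_iff_right (by simpa using hκ0) ENNReal.ofReal_ne_top] at h5
  have hmono : Monotone fun n : ℕ => A (1 - 1 / ((n : ℝ) + 2)) := by
    intro m n hmn
    apply hAmono
    gcongr
  have hsub : Set.Ioc 0 (2 * π) ∩ {θ | ENNReal.ofReal t < maxRad F θ} ⊆
      ⋃ n : ℕ, A (1 - 1 / ((n : ℝ) + 2)) := by
    rintro θ ⟨hθ, h⟩
    simp only [mem_ofPred_eq, maxRad, lt_iSup_iff] at h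
    obtain ⟨r, hr, h⟩ := h
    obtain ⟨n, hn⟩ := exists_nat_one_div_lt (sub_pos.2 hr.2)
    refine mem_iUnion.2 ⟨n, hθ, r, hr.1, ?_, by simpa [enorm_eq_nnnorm] using h⟩
    have : 1 / ((n : ℝ) + 2) ≤ 1 / ((n : ℝ) + 1) := by
      gcongr
      norm_num
    linarith
  refine (measure_mono hsub).trans ?_
  rw [hmono.measure_iUnion]
  refine iSup_le fun n => hAle _ ?_ ?_
  · have : 1 / ((n : ℝ) + 2) ≤ 1 / 2 := by
      gcongr
      have : (0 : ℝ) ≤ n := by positivity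
      linarith
    linarith
  · have : 0 < 1 / ((n : ℝ) + 2) := by positivity
    linarith


/-! ### Functions bounded by one and approximation of the unit -/

/-- Holomorphic on the disk and bounded by one there. -/
def Bd (g : ℂ → ℂ) : Prop := DifferentiableOn ℂ g unitDisk ∧ ∀ z ∈ unitDisk, ‖g z‖ ≤ 1

lemma diffContOnCl_of_lt {F : ℂ → ℂ} (hF : DifferentiableOn ℂ F unitDisk) {ρ : ℝ} (h0 : 0 < ρ)
    (h1 : ρ < 1) : DiffContOnCl ℂ F (Metric.ball 0 ρ) := by
  apply DifferentiableOn.diffContOnCl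
  rw [closure_ball _ h0.ne']
  exact hF.mono (Metric.closedBall_subset_ball h1)

lemma sphere_subset_closure_ball {ρ : ℝ} (h0 : 0 < ρ) :
    Metric.sphere (0 : ℂ) |ρ| ⊆ closure (Metric.ball 0 ρ) := by
  rw [abs_of_pos h0, closure_ball _ h0.ne']
  exact Metric.sphere_subset_closedBall

lemma continuousOn_poissonKernel {w : ℂ} {ρ : ℝ} (hw : w ∈ Metric.ball (0 : ℂ) ρ) :
    ContinuousOn (poissonKernel 0 w) (Metric.sphere 0 |ρ|) := by
  rw [poissonKernel_eq_re_herglotzRieszKernel]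
  exact Complex.continuous_re.comp_continuousOn (continuousOn_herglotzRieszKernel_sphere hw)

lemma poissonKernel_nonneg {w z : ℂ} {ρ : ℝ} (hw : w ∈ Metric.ball (0 : ℂ) ρ)
    (hz : z ∈ Metric.sphere (0 : ℂ) ρ) : 0 ≤ poissonKernel 0 w z := by
  rw [poissonKernel_def]
  apply div_nonneg _ (by positivity)
  simp only [sub_zero]
  rw [mem_sphere_zero_iff_norm] at hz
  rw [mem_ball_zero_iff] at hw
  nlinarith [norm_nonneg w]

lemma poissonKernel_le {w z : ℂ} {ρ : ℝ} (hw : w ∈ Metric.ball (0 : ℂ) ρ)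
    (hz : z ∈ Metric.sphere (0 : ℂ) ρ) :
    poissonKernel 0 w z ≤ (ρ + ‖w‖) / (ρ - ‖w‖) := by
  rw [poissonKernel_eq_re_herglotzRieszKernel]
  have := re_herglotzRieszKernel_le hz hw
  simpa [herglotzRieszKernel_def] using this

lemma circleIntegrable_poisson_mul {w : ℂ} {ρ : ℝ} (hw : w ∈ Metric.ball (0 : ℂ) ρ)
    {φ : ℂ → ℝ} (hφ : CircleIntegrable φ 0 ρ) :
    CircleIntegrable (fun z => poissonKernel 0 w z * φ z) 0 ρ :=
  hφ.continuousOn_smul (continuousOn_poissonKernel hw)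

lemma circleAverage_poisson_re {F : ℂ → ℂ} {ρ : ℝ} (h0 : 0 < ρ)
    (hF : DiffContOnCl ℂ F (Metric.ball 0 ρ)) {w : ℂ} (hw : w ∈ Metric.ball (0 : ℂ) ρ) :
    Real.circleAverage (fun z => poissonKernel 0 w z * (F z).re) 0 ρ = (F w).re := by
  have h := hF.circleAverage_poissonKernel_smul hw
  have hi : CircleIntegrable (poissonKernel 0 w • F) 0 ρ := by
    apply ContinuousOn.circleIntegrable'
    exact (continuousOn_poissonKernel hw).smul
      (hF.continuousOn.mono (sphere_subset_closure_ball h0))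
  have h2 := Complex.reCLM.circleAverage_comp_comm hi
  rw [h] at h2
  rw [← Complex.reCLM_apply, ← h2]
  congr 1
  funext z
  simp

lemma circleAverage_re_zero {F : ℂ → ℂ} {ρ : ℝ} (h0 : 0 < ρ)
    (hF : DiffContOnCl ℂ F (Metric.ball 0 ρ)) :
    Real.circleAverage (fun z => (F z).re) 0 ρ = (F 0).re := by
  rw [← circleAverage_poisson_re h0 hF (w := 0) (by simpa using h0)]
  apply Real.circleAverage_congr_sphere
  intro z hz
  rw [abs_of_pos h0, mem_sphere_zero_iff_norm] at hz
  have : poissonKernel 0 0 z = 1 := by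
    rw [poissonKernel_def]
    simp only [sub_zero, norm_zero, hz]
    field_simp
    simp
  simp [this]

lemma circleIntegrable_of_diffContOnCl {F : ℂ → ℂ} {ρ : ℝ} (h0 : 0 < ρ)
    (hF : DiffContOnCl ℂ F (Metric.ball 0 ρ)) {φ : ℂ → ℝ} (hφ : Continuous φ) :
    CircleIntegrable (fun z => φ (F z)) 0 ρ := by
  apply ContinuousOn.circleIntegrable'
  exact hφ.comp_continuousOn (hF.continuousOn.mono (sphere_subset_closure_ball h0))

lemma sphere_subset_unitDisk {ρ : ℝ} (h0 : 0 < ρ) (h1 : ρ < 1) {z : ℂ}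
    (hz : z ∈ Metric.sphere (0 : ℂ) |ρ|) : z ∈ unitDisk := by
  rw [abs_of_pos h0, mem_sphere_zero_iff_norm] at hz
  rw [unitDisk, mem_ball_zero_iff, hz]
  exact h1

lemma norm_one_sub_sq_le {a : ℂ} (ha : ‖a‖ ≤ 1) : ‖1 - a‖ ^ 2 ≤ 2 - 2 * a.re := by
  have h1 : ‖1 - a‖ ^ 2 = 1 - 2 * a.re + ‖a‖ ^ 2 := by
    rw [← Complex.normSq_eq_norm_sq, ← Complex.normSq_eq_norm_sq, Complex.normSq_apply,
      Complex.normSq_apply]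
    simp
    ring
  nlinarith [norm_nonneg a]

lemma Bd.circleAverage_le {g : ℂ → ℂ} (hg : Bd g) {c η : ℝ} (hc : g 0 = c) (hη : 0 < η)
    (hcη : 2 - 2 * c ≤ η ^ 2) {ρ : ℝ} (hρ : ρ ∈ Set.Ioo (0 : ℝ) 1) :
    Real.circleAverage (fun z => ‖(1 - g) z‖) 0 ρ ≤ η := by
  set G : ℂ → ℂ := fun z => ((2 - 2 * g z) / η + η) / 2 with hG
  have hGd : DifferentiableOn ℂ G unitDisk := by
    have := hg.1
    fun_prop
  have h1d : DifferentiableOn ℂ (1 - g) unitDisk := (differentiableOn_const 1).sub hg.1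
  have hGc := diffContOnCl_of_lt hGd hρ.1 hρ.2
  have hre : ∀ z, (G z).re = ((2 - 2 * (g z).re) / η + η) / 2 := by
    intro z
    have : G z = (((((2 - 2 * (g z).re) / η + η) / 2 : ℝ)) : ℂ)
        - (((g z).im / η : ℝ) : ℂ) * Complex.I := by
      simp only [hG]
      conv_lhs => rw [← Complex.re_add_im (g z)]
      push_cast
      ring
    rw [this]
    simp
  have h2 := Real.circleAverage_mono (c := 0) (R := ρ)
    (circleIntegrable_of_diffContOnCl hρ.1 (diffContOnCl_of_lt h1d hρ.1 hρ.2) continuous_norm)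
    (circleIntegrable_of_diffContOnCl hρ.1 hGc Complex.continuous_re)
    (by
      intro z hz
      have hzD := sphere_subset_unitDisk hρ.1 hρ.2 hz
      simp only [hre]
      have h3 := norm_one_sub_sq_le (hg.2 z hzD)
      have h4 : (1 - g) z = 1 - g z := rfl
      rw [h4]
      have h5 : ‖1 - g z‖ ≤ (‖1 - g z‖ ^ 2 / η + η) / 2 := by
        have : (‖1 - g z‖ ^ 2 / η + η) / 2 - ‖1 - g z‖ = (‖1 - g z‖ - η) ^ 2 / (2 * η) := by
          field_simp
          ring
        have : 0 ≤ (‖1 - g z‖ - η) ^ 2 / (2 * η) := by positivity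
        linarith
      refine h5.trans ?_
      gcongr)
  refine h2.trans ?_
  rw [circleAverage_re_zero hρ.1 hGc, hre, hc, Complex.ofReal_re]
  have : (2 - 2 * c) / η ≤ η := by
    rw [div_le_iff₀ hη]
    nlinarith
  linarith

lemma Bd.norm_one_sub_sq {g : ℂ → ℂ} (hg : Bd g) {w : ℂ} (hw : w ∈ unitDisk) :
    ‖1 - g w‖ ^ 2 ≤ 4 / (1 - ‖w‖) * (2 - 2 * (g 0).re) := by
  have hw' : ‖w‖ < 1 := by simpa [unitDisk] using hw
  have hw0 := norm_nonneg w
  set ρ := (1 + ‖w‖) / 2 with hρ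
  have h0 : 0 < ρ := by positivity
  have h1 : ρ < 1 := by linarith
  have hwρ : w ∈ Metric.ball (0 : ℂ) ρ := by
    rw [mem_ball_zero_iff]; linarith
  set G : ℂ → ℂ := fun z => 2 - 2 * g z with hG
  have hGd : DifferentiableOn ℂ G unitDisk := by
    have := hg.1
    fun_prop
  have hGc := diffContOnCl_of_lt hGd h0 h1
  have hGi := circleIntegrable_of_diffContOnCl h0 hGc Complex.continuous_re
  have hre : ∀ z, (G z).re = 2 - 2 * (g z).re := by
    intro z
    simp [hG]
  have h2 := Real.circleAverage_mono (c := 0) (R := ρ) (circleIntegrable_poisson_mul hwρ hGi)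
    (f₂ := fun z => ((ρ + ‖w‖) / (ρ - ‖w‖)) • (G z).re) (hGi.const_smul)
    (by
      intro z hz
      have hzD := sphere_subset_unitDisk h0 h1 hz
      rw [abs_of_pos h0] at hz
      apply mul_le_mul_of_nonneg_right (poissonKernel_le hwρ hz)
      rw [hre]
      have := (Complex.re_le_norm (g z)).trans (hg.2 z hzD)
      linarith)
  rw [circleAverage_poisson_re h0 hGc hwρ, Real.circleAverage_fun_smul,
    circleAverage_re_zero h0 hGc, hre, hre, smul_eq_mul] at h2
  refine (norm_one_sub_sq_le (hg.2 w hw)).trans (h2.trans ?_)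
  have h3 : (ρ + ‖w‖) / (ρ - ‖w‖) ≤ 4 / (1 - ‖w‖) := by
    rw [div_le_div_iff₀ (by linarith) (by linarith)]
    nlinarith
  apply mul_le_mul_of_nonneg_right h3
  have := (Complex.re_le_norm (g 0)).trans (hg.2 0 zero_mem_unitDisk)
  linarith

lemma maxRad_ne_top_ae {p : ℝ} (hp : 1 < p) {h : ℂ → ℂ} (hh : h ∈ MpClass p) :
    ∀ᵐ θ ∂(volume.restrict (Set.Ioc 0 (2 * π))), maxRad h θ ≠ ∞ := by
  have hm : Measurable fun θ => elogPlus (maxRad h θ) ^ p :=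
    (elogPlus_mono.measurable.comp (measurable_maxRad hh.1)).pow_const p
  have := ae_lt_top hm (lintegral_ne_top_of_mem hh)
  filter_upwards [this] with θ hθ h1
  rw [h1] at hθ
  simp [elogPlus, ENNReal.top_rpow_of_pos (show 0 < p by linarith)] at hθ

lemma dense_of_approx {p : ℝ} (hp : 1 < p) {I : Set (ℂ → ℂ)} (hI : IsIdealIn p I)
    (happ : ∀ η : ℝ, 0 < η → ∃ g ∈ I, Bd g ∧ ∃ c : ℝ, g 0 = c ∧ 2 - 2 * c ≤ η ^ 2) :
    IsDenseIn p I := by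
  intro h hh ε hε
  have hπ := Real.pi_pos
  have hch : ∀ n : ℕ, ∃ g ∈ I, Bd g ∧
      volume (Set.Ioc 0 (2 * π) ∩ {θ | ENNReal.ofReal ((1 / 2) ^ n) < maxRad (1 - g) θ}) ≤
        ENNReal.ofReal ((1 / 2) ^ n) := by
    intro n
    set η : ℝ := ((1 / 2) ^ n) ^ 2 / (1280 * π ^ 2) with hη
    have hη0 : 0 < η := by positivity
    obtain ⟨g, hgI, hg, c, hc, hcη⟩ := happ η hη0
    refine ⟨g, hgI, hg, ?_⟩
    have := weak_type (F := 1 - g) ((differentiableOn_const 1).sub hg.1)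
      (t := (1 / 2) ^ n) (by positivity) (fun ρ hρ => hg.circleAverage_le hc hη0 hcη hρ)
    refine this.trans (le_of_eq ?_)
    congr 1
    rw [hη]
    field_simp
  choose g hgI hg hgm using hch
  set μ := volume.restrict (Set.Ioc 0 (2 * π)) with hμ
  have h1d : ∀ n, DifferentiableOn ℂ (1 - g n) unitDisk :=
    fun n => (differentiableOn_const 1).sub (hg n).1
  have hae : ∀ᵐ θ ∂μ, ∀ᶠ n in atTop,
      θ ∉ {θ | ENNReal.ofReal ((1 / 2) ^ n) < maxRad (1 - g n) θ} := by
    apply ae_eventually_notMem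
    have : ∀ n, μ {θ | ENNReal.ofReal ((1 / 2) ^ n) < maxRad (1 - g n) θ} ≤
        ENNReal.ofReal ((1 / 2) ^ n) := by
      intro n
      rw [hμ, Measure.restrict_apply (measurableSet_lt measurable_const
        (measurable_maxRad (h1d n))), inter_comm]
      exact hgm n
    refine ne_top_of_le_ne_top ?_ (ENNReal.tsum_le_tsum this)
    rw [← ENNReal.ofReal_tsum_of_nonneg (fun k => by positivity) summable_geometric_two]
    exact ENNReal.ofReal_ne_top
  have hlim : Tendsto (fun n => ∫⁻ θ, elog1p (maxRad (h - h * g n) θ) ^ p ∂μ) atTop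
      (𝓝 (∫⁻ θ, 0 ∂μ)) := by
    refine tendsto_lintegral_of_dominated_convergence'
      (fun θ => (ENNReal.ofReal (Real.log 4) + elogPlus (maxRad h θ)) ^ p) ?_ ?_ ?_ ?_
    · intro n
      exact ((elog1p_mono.measurable.comp
        (measurable_maxRad (hh.1.sub (hh.1.mul (hg n).1)))).pow_const p).aemeasurable
    · intro n
      refine Eventually.of_forall fun θ => ?_
      refine ENNReal.rpow_le_rpow ?_ (by linarith)
      refine le_trans (elog1p_mono ?_) (elog1p_two_mul_le _)
      have e : h - h * g n = (1 - g n) * h := by ring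
      rw [e]
      refine (maxRad_mul_le _ _ θ).trans (mul_le_mul_left ?_ _)
      have := maxRad_le_of_bound (f := 1 - g n) (C := 2) (fun z hz => by
        have h2 := (hg n).2 z hz
        calc ‖1 - g n z‖ ≤ ‖(1 : ℂ)‖ + ‖g n z‖ := norm_sub_le _ _
          _ ≤ 2 := by rw [norm_one]; linarith) θ
      simpa using this
    · exact lintegral_const_add_rpow_ne_top hp ENNReal.ofReal_ne_top (lintegral_ne_top_of_mem hh)
    · filter_upwards [hae, maxRad_ne_top_ae hp hh] with θ h1 h2
      have h3 : Tendsto (fun n : ℕ => ENNReal.ofReal ((1 / 2) ^ n) * maxRad h θ) atTop (𝓝 0) := by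
        have h4 : Tendsto (fun n : ℕ => ENNReal.ofReal ((1 / 2 : ℝ) ^ n)) atTop (𝓝 0) := by
          rw [← ENNReal.ofReal_zero]
          exact ENNReal.tendsto_ofReal
            (tendsto_pow_atTop_nhds_zero_of_lt_one (by norm_num) (by norm_num))
        have := ENNReal.Tendsto.mul_const (b := maxRad h θ) h4 (Or.inr h2)
        simpa using this
      have h5 : Tendsto (fun n : ℕ => (ENNReal.ofReal ((1 / 2) ^ n) * maxRad h θ) ^ p) atTop
          (𝓝 0) := by
        have := h3.ennrpow_const p
        rwa [ENNReal.zero_rpow_of_pos (by linarith)] at this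
      refine tendsto_of_tendsto_of_tendsto_of_le_of_le' tendsto_const_nhds h5
        (Eventually.of_forall fun n => zero_le) ?_
      filter_upwards [h1] with n hn
      refine ENNReal.rpow_le_rpow ((elog1p_le _).trans ?_) (by linarith)
      have e : h - h * g n = (1 - g n) * h := by ring
      rw [e]
      refine (maxRad_mul_le _ _ θ).trans (mul_le_mul_left ?_ _)
      exact not_lt.1 hn
  have hlim2 : Tendsto (fun n => rhoMetric p h (h * g n)) atTop (𝓝 0) := by
    unfold rhoMetric
    have h1 := (ENNReal.Tendsto.div_const (b := ENNReal.ofReal (2 * π)) hlim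
      (Or.inr (by simp [hπ]))).ennrpow_const (1 / p)
    simpa [ENNReal.zero_rpow_of_pos (show 0 < p⁻¹ by positivity)] using h1
  obtain ⟨n, hn⟩ := ((tendsto_order.1 hlim2).2 ε hε).exists
  exact ⟨h * g n, hI.mul_mem _ hh _ (hgI n), hn⟩


/-! ### A bounded zero-free multiplier -/

lemma approx_on_circle {ψ : ℂ → ℝ} (hψ : ContinuousOn ψ (Metric.sphere 0 1)) {ε : ℝ}
    (hε : 0 < ε) : ∃ q : ℂ → ℂ, Differentiable ℂ q ∧
      ∀ z ∈ Metric.sphere (0 : ℂ) 1, |ψ z - (q z).re| ≤ ε := by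
  have : Fact ((0 : ℝ) < 1) := ⟨one_pos⟩
  have hmem : ∀ t : AddCircle (1 : ℝ), (AddCircle.toCircle t : ℂ) ∈ Metric.sphere (0 : ℂ) 1 := by
    intro t
    rw [mem_sphere_zero_iff_norm]
    exact Circle.norm_coe _
  have hcont : Continuous fun t : AddCircle (1 : ℝ) => (ψ (AddCircle.toCircle t : ℂ) : ℂ) := by
    refine Complex.continuous_ofReal.comp (hψ.comp_continuous ?_ hmem)
    exact continuous_subtype_val.comp AddCircle.continuous_toCircle
  set g : C(AddCircle (1 : ℝ), ℂ) := ⟨_, hcont⟩ with hg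
  have hcl : g ∈ (Submodule.span ℂ (range (fourier (T := (1 : ℝ))))).topologicalClosure := by
    rw [span_fourier_closure_eq_top]
    trivial
  obtain ⟨T, hT, hdist⟩ := Metric.mem_closure_iff.1 hcl ε hε
  have hrep : ∃ q₁ q₂ : ℂ → ℂ, Differentiable ℂ q₁ ∧ Differentiable ℂ q₂ ∧
      ∀ t : AddCircle (1 : ℝ), T t = q₁ (AddCircle.toCircle t) +
        (starRingEnd ℂ) (q₂ (AddCircle.toCircle t)) := by
    have hT' : T ∈ Submodule.span ℂ (range (fourier (T := (1 : ℝ)))) := hT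
    clear hdist hT
    induction hT' using Submodule.span_induction with
    | mem x hx =>
      obtain ⟨n, rfl⟩ := hx
      have hpow : ∀ (m : ℕ) (t : AddCircle (1 : ℝ)),
          fourier (m : ℤ) t = (AddCircle.toCircle t : ℂ) ^ m := by
        intro m t
        rw [fourier_apply, natCast_zsmul, AddCircle.toCircle_nsmul, Circle.coe_pow]
      rcases Int.eq_nat_or_neg n with ⟨m, rfl | rfl⟩
      · refine ⟨fun z => z ^ m, fun _ => 0, by fun_prop, by fun_prop, fun t => ?_⟩
        rw [hpow]
        simp
      · refine ⟨fun _ => 0, fun z => z ^ m, by fun_prop, by fun_prop, fun t => ?_⟩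
        rw [fourier_neg, hpow]
        simp
    | zero => exact ⟨fun _ => 0, fun _ => 0, by fun_prop, by fun_prop, fun t => by simp⟩
    | add x y _ _ hx hy =>
      obtain ⟨a, b, ha, hb, h1⟩ := hx
      obtain ⟨c, d, hc, hd, h2⟩ := hy
      refine ⟨fun z => a z + c z, fun z => b z + d z, by fun_prop, by fun_prop, fun t => ?_⟩
      rw [ContinuousMap.add_apply, h1, h2, map_add]
      ring
    | smul k x _ hx =>
      obtain ⟨a, b, ha, hb, h1⟩ := hx
      refine ⟨fun z => k * a z, fun z => (starRingEnd ℂ) k * b z, by fun_prop, by fun_prop,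
        fun t => ?_⟩
      rw [ContinuousMap.smul_apply, h1, map_mul, Complex.conj_conj, smul_eq_mul]
      ring
  obtain ⟨q₁, q₂, h1, h2, hq⟩ := hrep
  refine ⟨fun z => q₁ z + q₂ z, by fun_prop, fun z hz => ?_⟩
  obtain ⟨t, ht⟩ := (AddCircle.homeomorphCircle (T := (1 : ℝ)) one_ne_zero).surjective
    ⟨z, by simpa [Submonoid.unitSphere] using hz⟩
  rw [AddCircle.homeomorphCircle_apply] at ht
  have hz' : (AddCircle.toCircle t : ℂ) = z := by rw [ht]
  have h3 : dist (g t) (T t) ≤ ε := (ContinuousMap.dist_apply_le_dist t).trans hdist.le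
  rw [hq t, hz'] at h3
  have h4 : g t = (ψ z : ℂ) := by simp [hg, hz']
  rw [h4, Complex.dist_eq] at h3
  refine le_trans ?_ h3
  refine le_trans (le_of_eq ?_) (Complex.abs_re_le_norm _)
  simp

lemma circleAverage_poisson_one {w : ℂ} (hw : w ∈ Metric.ball (0 : ℂ) 1) :
    Real.circleAverage (fun z => poissonKernel 0 w z) 0 1 = 1 := by
  have := circleAverage_poisson_re one_pos (F := fun _ => 1)
    (diffContOnCl_const) hw
  simpa using this

lemma norm_le_exp_poisson {f : ℂ → ℂ} (hf : DiffContOnCl ℂ f (Metric.ball 0 1)) {ψ : ℂ → ℝ}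
    (hψ : ContinuousOn ψ (Metric.sphere 0 1))
    (h : ∀ z ∈ Metric.sphere (0 : ℂ) 1, ‖f z‖ ≤ Real.exp (ψ z)) {w : ℂ}
    (hw : w ∈ Metric.ball (0 : ℂ) 1) :
    ‖f w‖ ≤ Real.exp (Real.circleAverage (fun z => poissonKernel 0 w z * ψ z) 0 1) := by
  have hψi : CircleIntegrable ψ 0 1 := by
    apply ContinuousOn.circleIntegrable'
    simpa using hψ
  have key : ∀ ε : ℝ, 0 < ε → ‖f w‖ ≤
      Real.exp (Real.circleAverage (fun z => poissonKernel 0 w z * ψ z) 0 1 + ε) := by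
    intro ε hε
    obtain ⟨q, hq, hqψ⟩ := approx_on_circle hψ (half_pos hε)
    have hqc : DiffContOnCl ℂ q (Metric.ball 0 1) := hq.diffContOnCl
    have hec : DiffContOnCl ℂ (fun z => Complex.exp (-q z)) (Metric.ball 0 1) :=
      (hq.neg.cexp).diffContOnCl
    have h1 := Complex.norm_le_of_forall_mem_frontier_norm_le Metric.isBounded_ball
      (hec.smul hf) (C := Real.exp (ε / 2)) (by
        intro z hz
        rw [frontier_ball _ one_ne_zero] at hz
        rw [norm_smul, Complex.norm_exp]
        calc Real.exp (-q z).re * ‖f z‖ ≤ Real.exp (-q z).re * Real.exp (ψ z) := by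
              gcongr
              exact h z hz
          _ = Real.exp (ψ z - (q z).re) := by rw [← Real.exp_add]; congr 1; simp; ring
          _ ≤ _ := Real.exp_le_exp.2 ((le_abs_self _).trans (hqψ z hz)))
      (subset_closure hw)
    rw [norm_smul, Complex.norm_exp] at h1
    have h2 : (q w).re ≤ Real.circleAverage (fun z => poissonKernel 0 w z * ψ z) 0 1 + ε / 2 := by
      rw [← circleAverage_poisson_re one_pos hqc hw]
      have hpi : CircleIntegrable (fun z => poissonKernel 0 w z) 0 1 := by
        apply ContinuousOn.circleIntegrable'
        exact continuousOn_poissonKernel hw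
      have h3 : Real.circleAverage (fun z => poissonKernel 0 w z * ψ z) 0 1 + ε / 2 =
          Real.circleAverage (fun z => poissonKernel 0 w z * ψ z + (ε / 2) • poissonKernel 0 w z)
            0 1 := by
        rw [Real.circleAverage_fun_add (circleIntegrable_poisson_mul hw hψi)
          (f₂ := fun z => (ε / 2) • poissonKernel 0 w z) hpi.const_smul,
          Real.circleAverage_fun_smul, circleAverage_poisson_one hw]
        simp
      rw [h3]
      apply Real.circleAverage_mono
      · exact circleIntegrable_poisson_mul hw
          (circleIntegrable_of_diffContOnCl one_pos hqc Complex.continuous_re)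
      · exact (circleIntegrable_poisson_mul hw hψi).add hpi.const_smul
      · intro z hz
        rw [abs_one] at hz
        have h4 := poissonKernel_nonneg hw hz
        have h5 := abs_le.1 (hqψ z hz)
        simp only [smul_eq_mul]
        nlinarith [h5.1]
    have h6 : ‖f w‖ = Real.exp (q w).re * (Real.exp (-q w).re * ‖f w‖) := by
      rw [← mul_assoc, ← Real.exp_add]
      simp
    rw [h6]
    calc _ ≤ Real.exp (q w).re * Real.exp (ε / 2) := by gcongr
      _ = Real.exp ((q w).re + ε / 2) := (Real.exp_add _ _).symm
      _ ≤ _ := Real.exp_le_exp.2 (by linarith)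
  have hlim : Tendsto (fun ε : ℝ => Real.exp (Real.circleAverage
      (fun z => poissonKernel 0 w z * ψ z) 0 1 + ε)) (𝓝[>] 0)
      (𝓝 (Real.exp (Real.circleAverage (fun z => poissonKernel 0 w z * ψ z) 0 1))) := by
    have : Continuous fun ε : ℝ => Real.exp (Real.circleAverage
      (fun z => poissonKernel 0 w z * ψ z) 0 1 + ε) := by fun_prop
    have := (this.tendsto 0).mono_left (nhdsWithin_le_nhds (s := Ioi 0))
    simpa using this
  refine ge_of_tendsto hlim ?_
  filter_upwards [self_mem_nhdsWithin] with ε hε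
  exact key ε hε

/-- The boundary majorant. -/
def bdryMaj (f : ℂ → ℂ) (z : ℂ) : ℝ :=
  (elog1p (⨆ r ∈ Set.Ico (0 : ℝ) 1, (‖f (r * z)‖₊ : ℝ≥0∞))).toReal

lemma bdryMaj_circle (f : ℂ → ℂ) (θ : ℝ) :
    bdryMaj f (circleMap 0 1 θ) = (elog1p (maxRad f θ)).toReal := by
  simp [bdryMaj, maxRad, circlePt, circleMap]

lemma le_one_add_rpow {p : ℝ} (hp : 1 < p) (x : ℝ≥0∞) : x ≤ 1 + x ^ p := by
  rcases le_total x 1 with h | h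
  · exact h.trans le_self_add
  · calc x = x ^ (1 : ℝ) := (ENNReal.rpow_one x).symm
      _ ≤ x ^ p := ENNReal.rpow_le_rpow_of_exponent_le h hp.le
      _ ≤ _ := le_add_self

lemma lintegral_elog1p_ne_top {p : ℝ} (hp : 1 < p) {f : ℂ → ℂ} (hf : f ∈ MpClass p) :
    ∫⁻ θ in Set.Ioc 0 (2 * π), elog1p (maxRad f θ) ≠ ∞ := by
  have h1 := lintegral_const_add_rpow_ne_top hp
    (c := ENNReal.ofReal (Real.log 4)) (by simp) (lintegral_ne_top_of_mem hf)
  have h2 : ∫⁻ θ in Set.Ioc 0 (2 * π), (1 + (ENNReal.ofReal (Real.log 4) +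
      elogPlus (maxRad f θ)) ^ p) ≠ ∞ := by
    rw [lintegral_add_left measurable_const]
    exact ENNReal.add_ne_top.2 ⟨lintegral_Ioc_const_ne_top _ (by simp), h1⟩
  refine ne_top_of_le_ne_top h2 (lintegral_mono fun θ => ?_)
  refine le_trans ?_ (le_one_add_rpow hp _)
  refine le_trans (elog1p_mono ?_) (elog1p_two_mul_le _)
  rw [two_mul]
  exact le_self_add

lemma circleIntegrable_bdryMaj {p : ℝ} (hp : 1 < p) {f : ℂ → ℂ} (hf : f ∈ MpClass p) :
    CircleIntegrable (bdryMaj f) 0 1 := by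
  unfold CircleIntegrable
  simp only [bdryMaj_circle]
  rw [intervalIntegrable_iff_integrableOn_Ioc_of_le (by positivity)]
  exact integrable_toReal_of_lintegral_ne_top
    (elog1p_mono.measurable.comp (measurable_maxRad hf.1)).aemeasurable
    (lintegral_elog1p_ne_top hp hf)

lemma norm_le_exp_bdryMaj {p : ℝ} (hp : 1 < p) {f : ℂ → ℂ} (hf : f ∈ MpClass p) {w : ℂ}
    (hw : w ∈ Metric.ball (0 : ℂ) 1) :
    ‖f w‖ ≤ Real.exp (Real.circleAverage (fun z => poissonKernel 0 w z * bdryMaj f z) 0 1) := by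
  have hπ := Real.pi_pos
  have key : ∀ R ∈ Set.Ioo (0 : ℝ) 1, ‖f (R * w)‖ ≤
      Real.exp (Real.circleAverage (fun z => poissonKernel 0 w z * bdryMaj f z) 0 1) := by
    intro R hR
    have hmaps : MapsTo (fun z : ℂ => (R : ℂ) * z) (Metric.closedBall 0 1) unitDisk := by
      intro z hz
      rw [mem_closedBall_zero_iff] at hz
      rw [unitDisk, mem_ball_zero_iff, norm_mul, Complex.norm_real, Real.norm_of_nonneg hR.1.le]
      nlinarith [hR.1, hR.2]
    have hd : DifferentiableOn ℂ (fun z => f (R * z)) (Metric.closedBall 0 1) :=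
      hf.1.comp (by fun_prop) hmaps
    have hdc : DiffContOnCl ℂ (fun z => f (R * z)) (Metric.ball 0 1) := by
      apply DifferentiableOn.diffContOnCl
      rwa [closure_ball _ one_ne_zero]
    have hψ : ContinuousOn (fun z => Real.log (1 + ‖f (R * z)‖)) (Metric.sphere 0 1) := by
      apply ContinuousOn.log
      · exact continuousOn_const.add (hd.continuousOn.mono Metric.sphere_subset_closedBall).norm
      · intro z _
        positivity
    have h1 := norm_le_exp_poisson hdc hψ (by
      intro z _
      rw [Real.exp_log (by positivity)]
      linarith) hw
    refine h1.trans (Real.exp_le_exp.2 ?_)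
    have hi1 : CircleIntegrable (fun z => poissonKernel 0 w z * Real.log (1 + ‖f (R * z)‖)) 0 1 := by
      apply circleIntegrable_poisson_mul hw
      apply ContinuousOn.circleIntegrable'
      simpa using hψ
    have hi2 := circleIntegrable_poisson_mul hw (circleIntegrable_bdryMaj hp hf)
    rw [Real.circleAverage_def, Real.circleAverage_def, smul_eq_mul, smul_eq_mul]
    refine mul_le_mul_of_nonneg_left ?_ (by positivity)
    have h2π : (0 : ℝ) ≤ 2 * π := by positivity
    rw [intervalIntegral.integral_of_le h2π, intervalIntegral.integral_of_le h2π]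
    have j1 := (intervalIntegrable_iff_integrableOn_Ioc_of_le h2π).1 hi1
    have j2 := (intervalIntegrable_iff_integrableOn_Ioc_of_le h2π).1 hi2
    refine setIntegral_mono_ae_restrict j1 j2 ?_
    filter_upwards [maxRad_ne_top_ae hp hf] with θ hθ
    refine mul_le_mul_of_nonneg_left ?_ (poissonKernel_nonneg hw (by simp))
    rw [bdryMaj_circle, elog1p, if_neg hθ, ENNReal.toReal_ofReal]
    · apply Real.log_le_log (by positivity)
      have h3 := le_maxRad f (r := R) ⟨hR.1.le, hR.2⟩ θ
      have h4 := ENNReal.toReal_mono hθ h3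
      have h5 : (R : ℂ) * circleMap 0 1 θ = circlePt R θ := by simp [circlePt, circleMap]
      rw [h5]
      simpa using h4
    · apply Real.log_nonneg
      linarith [ENNReal.toReal_nonneg (a := maxRad f θ)]
  have hlim : Tendsto (fun R : ℝ => ‖f (R * w)‖) (𝓝[<] 1) (𝓝 ‖f w‖) := by
    have hc : ContinuousAt f w := (hf.1.continuousOn).continuousAt (isOpen_unitDisk.mem_nhds hw)
    have h1 : Tendsto (fun R : ℝ => (R : ℂ) * w) (𝓝[<] 1) (𝓝 w) := by
      have : Continuous fun R : ℝ => (R : ℂ) * w := by fun_prop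
      have := (this.tendsto 1).mono_left (nhdsWithin_le_nhds (s := Iio 1))
      simpa using this
    exact (hc.tendsto.comp h1).norm
  refine le_of_tendsto hlim ?_
  filter_upwards [Ioo_mem_nhdsLT (show (0 : ℝ) < 1 by norm_num)] with R hR
  exact key R hR

lemma exists_multiplier {p : ℝ} (hp : 1 < p) {f : ℂ → ℂ} (hf : f ∈ MpClass p) :
    ∃ h : ℂ → ℂ, Bd h ∧ (∀ z ∈ unitDisk, h z ≠ 0) ∧ ∀ z ∈ unitDisk, ‖h z * f z‖ ≤ 1 := by
  have hci := circleIntegrable_bdryMaj hp hf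
  have hci' : CircleIntegrable (fun z => (bdryMaj f z : ℂ)) 0 1 := by
    simp only [CircleIntegrable, intervalIntegrable_iff] at hci ⊢
    exact Complex.ofRealCLM.integrable_comp hci
  set H : ℂ → ℂ := fun w => Real.circleAverage
    (fun ζ => herglotzRieszKernel 0 w ζ • (bdryMaj f ζ : ℂ)) 0 1 with hH
  have hHd : DifferentiableOn ℂ H unitDisk :=
    differentiableOn_circleAverage_herglotzRieszKernel_smul hci'
  have hre : ∀ w ∈ unitDisk, (H w).re =
      Real.circleAverage (fun z => poissonKernel 0 w z * bdryMaj f z) 0 1 := by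
    intro w hw
    rw [hH]
    simp only
    rw [re_circleAverage_herglotzRieszKernel_smul hci hw, ← poissonKernel_eq_re_herglotzRieszKernel]
    rfl
  have hnn : ∀ w ∈ unitDisk, 0 ≤ (H w).re := by
    intro w hw
    rw [hre w hw]
    apply Real.circleAverage_nonneg_of_nonneg
    intro z hz
    rw [abs_one] at hz
    exact mul_nonneg (poissonKernel_nonneg hw hz) ENNReal.toReal_nonneg
  refine ⟨fun z => Complex.exp (-H z), ⟨hHd.neg.cexp, fun z hz => ?_⟩, fun z _ =>
    Complex.exp_ne_zero _, fun z hz => ?_⟩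
  · rw [Complex.norm_exp]
    have := hnn z hz
    apply Real.exp_le_one_iff.2
    simpa using this
  · have h1 := norm_le_exp_bdryMaj hp hf hz
    rw [← hre z hz] at h1
    rw [norm_mul, Complex.norm_exp]
    calc Real.exp (-H z).re * ‖f z‖ ≤ Real.exp (-H z).re * Real.exp (H z).re := by gcongr
      _ = 1 := by rw [← Real.exp_add]; simp


/-! ### Ideal structure -/

lemma mem_unitDisk_iff {z : ℂ} : z ∈ unitDisk ↔ ‖z‖ < 1 := by simp [unitDisk]

lemma Bd.mem {p : ℝ} (hp : 1 < p) {g : ℂ → ℂ} (hg : Bd g) : g ∈ MpClass p :=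
  mem_of_bounded hp hg.1 hg.2

lemma not_mem_of_eqOn_one {p : ℝ} (hp : 1 < p) {I : Set (ℂ → ℂ)} (hI : IsPrimeIdealIn p I)
    (hnd : ¬ IsDenseIn p I) {g : ℂ → ℂ} (hg : EqOn g 1 unitDisk) : g ∉ I := by
  intro hgI
  refine hnd (dense_of_approx hp hI.1 fun η hη => ⟨g, hgI, ⟨(hI.1.subset hgI).1, ?_⟩, 1, ?_, ?_⟩)
  · intro z hz
    simp [hg hz]
  · simp [hg zero_mem_unitDisk]
  · nlinarith

lemma ideal_congr {p : ℝ} (hp : 1 < p) {I : Set (ℂ → ℂ)} (hI : IsPrimeIdealIn p I)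
    (hnd : ¬ IsDenseIn p I) {f g : ℂ → ℂ} (hf : f ∈ I) (h : EqOn f g unitDisk) : g ∈ I := by
  have he1 : EqOn (unitDisk.indicator (1 : ℂ → ℂ)) 1 unitDisk := fun z hz => by
    simp [Set.indicator_of_mem hz]
  have he : unitDisk.indicator (1 : ℂ → ℂ) ∈ MpClass p := by
    refine mem_of_bounded hp (C := 1) ?_ ?_
    · exact (differentiableOn_const (1 : ℂ)).congr fun z hz => he1 hz
    · intro z hz
      simp [he1 hz]
  have hd : g - f ∈ MpClass p := mem_congr (zero_mem_Mp hp) fun z hz => by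
    simp [h hz]
  have hprod : (g - f) * unitDisk.indicator (1 : ℂ → ℂ) = 0 := by
    funext z
    by_cases hz : z ∈ unitDisk
    · simp [h hz]
    · simp [Set.indicator_of_notMem hz]
  rcases hI.2 _ hd _ he (hprod ▸ hI.1.zero_mem) with h1 | h1
  · have := hI.1.add_mem _ hf _ h1
    simpa using this
  · exact absurd h1 (not_mem_of_eqOn_one hp hI hnd he1)

lemma prime_congr {p : ℝ} (hp : 1 < p) {I : Set (ℂ → ℂ)} (hI : IsPrimeIdealIn p I)
    (hnd : ¬ IsDenseIn p I) {f g k : ℂ → ℂ} (hf : f ∈ MpClass p) (hg : g ∈ MpClass p)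
    (hk : k ∈ I) (h : EqOn k (f * g) unitDisk) : f ∈ I ∨ g ∈ I :=
  hI.2 f hf g hg (ideal_congr hp hI hnd hk h)

lemma sub_mem_Mp {p : ℝ} (hp : 1 < p) (w : ℂ) : (fun z : ℂ => z - w) ∈ MpClass p := by
  refine mem_of_bounded hp (C := 1 + ‖w‖) (by fun_prop) ?_
  intro z hz
  rw [mem_unitDisk_iff] at hz
  exact (norm_sub_le _ _).trans (by linarith)

lemma const_mem_Mp {p : ℝ} (hp : 1 < p) (c : ℂ) : (fun _ : ℂ => c) ∈ MpClass p :=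
  mem_of_bounded hp (C := ‖c‖) (by fun_prop) fun z _ => le_rfl

lemma eq_vanishing {p : ℝ} (hp : 1 < p) {I : Set (ℂ → ℂ)} (hI : IsPrimeIdealIn p I)
    (hnd : ¬ IsDenseIn p I) {w : ℂ} (hw : w ∈ unitDisk) (hwI : (fun z : ℂ => z - w) ∈ I) :
    I = {f ∈ MpClass p | f w = 0} := by
  have key : ∀ f ∈ MpClass p, (fun z => (z - w) * dslope f w z) ∈ I := by
    intro f hf
    have := hI.1.mul_mem _ (mem_dslope hp hf hw) _ hwI
    convert this using 1
    funext z
    simp [mul_comm]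
  have hid : ∀ (f : ℂ → ℂ) z, (z - w) * dslope f w z = f z - f w := by
    intro f z
    simpa using sub_smul_dslope f w z
  ext f
  constructor
  · intro hf
    refine ⟨hI.1.subset hf, ?_⟩
    by_contra hne
    have h1 := hI.1.add_mem _ hf _ (hI.1.neg_mem _ (key f (hI.1.subset hf)))
    have h2 := hI.1.mul_mem _ (const_mem_Mp hp (f w)⁻¹) _ h1
    refine not_mem_of_eqOn_one hp hI hnd ?_ h2
    intro z hz
    simp [hid, hne]
  · rintro ⟨hf, h0⟩
    have := key f hf
    convert this using 1
    funext z
    rw [hid, h0, sub_zero]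

lemma pow_mem_imp {p : ℝ} (hp : 1 < p) {I : Set (ℂ → ℂ)} (hI : IsPrimeIdealIn p I)
    (hnd : ¬ IsDenseIn p I) {R : ℂ → ℂ} (hR : Bd R) (n : ℕ) (h : R ^ n ∈ I) : R ∈ I := by
  induction n with
  | zero => exact absurd h (not_mem_of_eqOn_one hp hI hnd fun z _ => by simp)
  | succ n ih =>
    rw [pow_succ] at h
    have hb : Bd (R ^ n) := by
      refine ⟨hR.1.pow n, fun z hz => ?_⟩
      rw [Pi.pow_apply, norm_pow]
      exact pow_le_one₀ (norm_nonneg _) (hR.2 z hz)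
    rcases hI.2 _ (hb.mem hp) _ (hR.mem hp) h with h | h
    · exact ih h
    · exact h

/-- Some member does not vanish at the origin. -/
lemma exists_ne_zero_at_zero {p : ℝ} (hp : 1 < p) {I : Set (ℂ → ℂ)} (hI : IsPrimeIdealIn p I)
    (hnd : ¬ IsDenseIn p I) (hnz : ∃ f ∈ I, ¬ Set.EqOn f 0 unitDisk)
    (hno : ∀ w ∈ unitDisk, (fun z : ℂ => z - w) ∉ I) : ∃ f ∈ I, f 0 ≠ 0 := by
  by_contra! hall
  obtain ⟨f, hf, hfne⟩ := hnz
  have hit : ∀ n : ℕ, (Function.swap dslope (0 : ℂ))^[n] f ∈ I := by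
    intro n
    induction n with
    | zero => exact hf
    | succ n ih =>
      rw [Function.iterate_succ_apply']
      set g := (Function.swap dslope (0 : ℂ))^[n] f with hg
      have hgz := hall g ih
      change dslope g 0 ∈ I
      refine (prime_congr hp hI hnd (sub_mem_Mp hp 0)
        (mem_dslope hp (hI.1.subset ih) zero_mem_unitDisk) ih ?_).resolve_left
        (hno 0 zero_mem_unitDisk)
      intro z hz
      have := sub_smul_dslope g 0 z
      simp only [hgz, sub_zero, smul_eq_mul] at this
      simp [← this]
  have han : AnalyticOnNhd ℂ f unitDisk := (hI.1.subset hf).1.analyticOnNhd isOpen_unitDisk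
  obtain ⟨q, hq⟩ := han 0 zero_mem_unitDisk
  have hq0 : q ≠ 0 := by
    intro h0
    apply hfne
    refine han.eqOn_zero_of_preconnected_of_eventuallyEq_zero
      (convex_ball (0 : ℂ) 1).isPreconnected zero_mem_unitDisk ?_
    exact hq.locally_zero_iff.2 h0
  exact hq.iterate_dslope_fslope_ne_zero hq0 (hall _ (hit _))

/-- The positive real normalized members. -/
lemma exists_normalized {p : ℝ} (hp : 1 < p) {I : Set (ℂ → ℂ)} (hI : IsPrimeIdealIn p I)
    (hnd : ¬ IsDenseIn p I) (hnz : ∃ f ∈ I, ¬ Set.EqOn f 0 unitDisk)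
    (hno : ∀ w ∈ unitDisk, (fun z : ℂ => z - w) ∉ I) :
    ∃ g ∈ I, Bd g ∧ ∃ x : ℝ, 0 < x ∧ g 0 = x := by
  obtain ⟨f, hf, hf0⟩ := exists_ne_zero_at_zero hp hI hnd hnz hno
  obtain ⟨h, hh, hh0, hb⟩ := exists_multiplier hp (hI.1.subset hf)
  set a := h 0 * f 0 with ha
  have ha0 : a ≠ 0 := mul_ne_zero (hh0 0 zero_mem_unitDisk) hf0
  have han : (‖a‖ : ℂ) ≠ 0 := by simpa using ha0
  set c : ℂ := (starRingEnd ℂ) a / ‖a‖ with hc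
  have hcn : ‖c‖ = 1 := by
    rw [hc, norm_div]
    simp [ha0]
  have hm : (fun _ : ℂ => c) * (h * f) ∈ I :=
    hI.1.mul_mem _ (const_mem_Mp hp c) _ (hI.1.mul_mem _ (hh.mem hp) _ hf)
  refine ⟨_, hm, ⟨(hI.1.subset hm).1, ?_⟩, ‖a‖, norm_pos_iff.2 ha0, ?_⟩
  · intro z hz
    simp only [Pi.mul_apply, norm_mul, hcn, one_mul]
    simpa using hb z hz
  · simp only [Pi.mul_apply, ← ha]
    rw [hc, div_mul_eq_mul_div, mul_comm, Complex.mul_conj, Complex.normSq_eq_norm_sq]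
    push_cast
    field_simp

/-- Zero-free bounded functions have logarithms. -/
lemma exists_log {G : ℂ → ℂ} (hG : DifferentiableOn ℂ G unitDisk)
    (hz : ∀ z ∈ unitDisk, G z ≠ 0) {x : ℝ} (hx : 0 < x) (h0 : G 0 = x) :
    ∃ L : ℂ → ℂ, DifferentiableOn ℂ L unitDisk ∧ L 0 = Real.log x ∧
      ∀ z ∈ unitDisk, Complex.exp (L z) = G z := by
  have hd : DifferentiableOn ℂ (fun z => deriv G z / G z) (Metric.ball 0 1) :=
    (hG.deriv isOpen_unitDisk).div hG hz
  obtain ⟨L, hL0, hL⟩ := hd.isExactOn_ball.with_val_at 0 (Real.log x : ℂ)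
  have hLd : DifferentiableOn ℂ L unitDisk := fun z hz =>
    (hL z hz).differentiableAt.differentiableWithinAt
  refine ⟨L, hLd, hL0, ?_⟩
  have hc : ∀ z ∈ unitDisk, HasDerivAt (fun z => Complex.exp (-L z) * G z) 0 z := by
    intro z hzz
    have h1 : HasDerivAt (fun z => Complex.exp (-L z))
        (Complex.exp (-L z) * -(deriv G z / G z)) z := (hL z hzz).neg.cexp
    have h2 := (hG.differentiableAt (isOpen_unitDisk.mem_nhds hzz)).hasDerivAt
    have e : deriv G z / G z * G z = deriv G z := div_mul_cancel₀ _ (hz z hzz)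
    have e2 : Complex.exp (-L z) * -(deriv G z / G z) * G z + Complex.exp (-L z) * deriv G z = 0 := by
      linear_combination -Complex.exp (-L z) * e
    have h3 := h1.mul h2
    rw [e2] at h3
    exact h3
  intro z hzz
  have := isOpen_unitDisk.is_const_of_deriv_eq_zero (convex_ball (0 : ℂ) 1).isPreconnected
    (fun z hz => (hc z hz).differentiableAt.differentiableWithinAt)
    (fun z hz => (hc z hz).deriv) hzz zero_mem_unitDisk
  rw [hL0, h0, Complex.exp_neg, Complex.exp_neg, ← Complex.ofReal_exp, Real.exp_log hx] at this
  have hx' : (x : ℂ) ≠ 0 := by exact_mod_cast hx.ne'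
  rw [inv_mul_cancel₀ hx'] at this
  field_simp at this
  exact this.symm

lemma zero_free_not_mem {p : ℝ} (hp : 1 < p) {I : Set (ℂ → ℂ)} (hI : IsPrimeIdealIn p I)
    (hnd : ¬ IsDenseIn p I) {G : ℂ → ℂ} (hG : Bd G)
    (hz : ∀ z ∈ unitDisk, G z ≠ 0) {x : ℝ} (hx : 0 < x) (h0 : G 0 = x) : G ∉ I := by
  intro hGI
  obtain ⟨L, hL, hL0, hexp⟩ := exists_log hG.1 hz hx h0
  have hlim : Tendsto (fun n : ℕ => 2 - 2 * Real.exp (Real.log x / ((n : ℝ) + 1))) atTop (𝓝 0) := by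
    have h1 : Tendsto (fun n : ℕ => Real.log x / ((n : ℝ) + 1)) atTop (𝓝 0) :=
      tendsto_const_nhds.div_atTop
        (tendsto_atTop_add_const_right _ _ tendsto_natCast_atTop_atTop)
    have h2 := ((Real.continuous_exp.tendsto 0).comp h1).const_mul 2 |>.const_sub 2
    simpa using h2
  refine hnd (dense_of_approx hp hI.1 fun η hη => ?_)
  obtain ⟨n, hn⟩ := (hlim.eventually (gt_mem_nhds (show 0 < η ^ 2 by positivity))).exists
  set R : ℂ → ℂ := fun z => Complex.exp (L z / ((n : ℂ) + 1)) with hR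
  have hn0 : ((n : ℂ) + 1) ≠ 0 := by exact_mod_cast Nat.succ_ne_zero n
  have hpow : EqOn G (R ^ (n + 1)) unitDisk := by
    intro z hzz
    simp only [hR, Pi.pow_apply]
    rw [← Complex.exp_nat_mul, ← hexp z hzz]
    congr 1
    push_cast
    field_simp
  have hRb : Bd R := by
    refine ⟨(hL.div_const _).cexp, fun z hzz => ?_⟩
    have h1 := hG.2 z hzz
    rw [hpow hzz, Pi.pow_apply, norm_pow] at h1
    exact (pow_le_one_iff_of_nonneg (norm_nonneg _) (Nat.succ_ne_zero n)).1 h1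
  refine ⟨R, pow_mem_imp hp hI hnd hRb (n + 1) (ideal_congr hp hI hnd hGI hpow), hRb,
    Real.exp (Real.log x / ((n : ℝ) + 1)), ?_, hn.le⟩
  simp only [hR, hL0]
  push_cast
  rfl


/-! ### Dividing out zeros -/

lemma one_sub_conj_mul_ne {a z : ℂ} (ha : a ∈ unitDisk) (hz : z ∈ unitDisk) :
    1 - (starRingEnd ℂ) a * z ≠ 0 := by
  rw [mem_unitDisk_iff] at ha hz
  intro h
  have h1 : (starRingEnd ℂ) a * z = 1 := (sub_eq_zero.1 h).symm
  have h2 : ‖(starRingEnd ℂ) a * z‖ = 1 := by rw [h1]; simp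
  rw [norm_mul, Complex.norm_conj] at h2
  nlinarith [norm_nonneg a, norm_nonneg z]

lemma norm_sub_le_norm_one_sub_conj {a z : ℂ} (ha : a ∈ unitDisk) (hz : z ∈ unitDisk) :
    ‖a - z‖ ≤ ‖1 - (starRingEnd ℂ) a * z‖ := by
  rw [mem_unitDisk_iff] at ha hz
  have hid : ‖1 - (starRingEnd ℂ) a * z‖ ^ 2 - ‖a - z‖ ^ 2 =
      (1 - ‖a‖ ^ 2) * (1 - ‖z‖ ^ 2) := by
    simp only [← Complex.normSq_eq_norm_sq, Complex.normSq_apply]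
    simp
    ring
  have h1 : 0 ≤ (1 - ‖a‖ ^ 2) * (1 - ‖z‖ ^ 2) := by
    apply mul_nonneg <;> nlinarith [norm_nonneg a, norm_nonneg z]
  exact (sq_le_sq₀ (norm_nonneg _) (norm_nonneg _)).1 (by linarith)

lemma bd_blaschkeFactor {a : ℂ} (ha : a ∈ unitDisk) (ha0 : a ≠ 0) : Bd (blaschkeFactor a) := by
  constructor
  · unfold blaschkeFactor
    refine (differentiableOn_const _).mul (DifferentiableOn.div (by fun_prop) (by fun_prop) ?_)
    intro z hz
    exact one_sub_conj_mul_ne ha hz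
  · intro z hz
    have h1 : 0 < ‖1 - (starRingEnd ℂ) a * z‖ := norm_pos_iff.2 (one_sub_conj_mul_ne ha hz)
    have h2 : ‖(‖a‖ : ℂ) / a‖ = 1 := by
      rw [norm_div]
      simp [ha0]
    rw [blaschkeFactor, norm_mul, h2, one_mul, norm_div, div_le_one h1]
    exact norm_sub_le_norm_one_sub_conj ha hz

lemma blaschke_circle_bound {a z : ℂ} {R : ℝ} (haR : ‖a‖ < R) (hR : R < 1) (hz : ‖z‖ = R) :
    ‖1 - (starRingEnd ℂ) a * z‖ ≤ (1 / R) * (1 + (1 - R ^ 2) / (R - ‖a‖)) * ‖z - a‖ := by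
  have hR0 : 0 < R := (norm_nonneg a).trans_lt haR
  have hd : R - ‖a‖ ≤ ‖z - a‖ := by rw [← hz]; exact norm_sub_norm_le z a
  have hRa : 0 < R - ‖a‖ := by linarith
  have h1 : R * ‖1 - (starRingEnd ℂ) a * z‖ = ‖z - a * (R : ℂ) ^ 2‖ := by
    have e1 : (R : ℂ) ^ 2 = z * (starRingEnd ℂ) z := by
      rw [Complex.mul_conj, Complex.normSq_eq_norm_sq, hz]
      push_cast
      rfl
    have e2 : z - a * (R : ℂ) ^ 2 = z * (starRingEnd ℂ) (1 - (starRingEnd ℂ) a * z) := by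
      rw [e1]
      simp only [map_sub, map_mul, map_one, Complex.conj_conj]
      ring
    rw [e2, norm_mul, Complex.norm_conj, hz]
  have h2 : ‖z - a * (R : ℂ) ^ 2‖ ≤ ‖z - a‖ + (1 - R ^ 2) := by
    have : z - a * (R : ℂ) ^ 2 = (z - a) + a * ((1 - R ^ 2 : ℝ) : ℂ) := by push_cast; ring
    rw [this]
    refine (norm_add_le _ _).trans ?_
    rw [norm_mul, Complex.norm_real, Real.norm_of_nonneg (by nlinarith)]
    have : ‖a‖ * (1 - R ^ 2) ≤ 1 - R ^ 2 :=
      mul_le_of_le_one_left (by nlinarith) (by linarith)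
    linarith
  have h3 : 1 - R ^ 2 ≤ (1 - R ^ 2) / (R - ‖a‖) * ‖z - a‖ := by
    rw [div_mul_eq_mul_div, le_div_iff₀ hRa]
    exact mul_le_mul_of_nonneg_left hd (by nlinarith)
  rw [mul_assoc, div_mul_eq_mul_div, one_mul, le_div_iff₀ hR0, mul_comm, h1]
  linarith

/-- Removing a zero from a bounded member. -/
lemma blaschke_step {p : ℝ} (hp : 1 < p) {I : Set (ℂ → ℂ)} (hI : IsPrimeIdealIn p I)
    (hnd : ¬ IsDenseIn p I) (hno : ∀ w ∈ unitDisk, (fun z : ℂ => z - w) ∉ I)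
    {g : ℂ → ℂ} (hgI : g ∈ I) (hg : Bd g) {x : ℝ} (hx : 0 < x) (hg0 : g 0 = x)
    {a : ℂ} (ha : a ∈ unitDisk) (hga : g a = 0) :
    a ≠ 0 ∧ ∃ g' ∈ I, Bd g' ∧ g' 0 = ((x / ‖a‖ : ℝ) : ℂ) ∧
      ∃ b, Bd b ∧ EqOn g (b * g') unitDisk := by
  have ha0 : a ≠ 0 := by
    rintro rfl
    rw [hg0] at hga
    exact hx.ne' (by exact_mod_cast hga)
  refine ⟨ha0, ?_⟩
  have han : (‖a‖ : ℂ) ≠ 0 := by simpa using ha0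
  have ha1 : ‖a‖ < 1 := mem_unitDisk_iff.1 ha
  have hds : ∀ z, (z - a) * dslope g a z = g z := by
    intro z
    simpa [hga] using sub_smul_dslope g a z
  set g' : ℂ → ℂ := fun z => (1 - (starRingEnd ℂ) a * z) * (a / ‖a‖) * (-dslope g a z) with hg'
  have hb := bd_blaschkeFactor ha ha0
  have hfac : EqOn g (blaschkeFactor a * g') unitDisk := by
    intro z hz
    have h1 := one_sub_conj_mul_ne ha hz
    simp only [Pi.mul_apply, blaschkeFactor, hg', ← hds z]
    generalize 1 - (starRingEnd ℂ) a * z = D at h1 ⊢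
    field_simp
    ring
  have hgd : DifferentiableOn ℂ g' unitDisk := by
    have := (mem_dslope hp (hI.1.subset hgI) ha).1
    rw [hg']
    fun_prop
  have hbound : ∀ z ∈ unitDisk, ‖g' z‖ ≤ 1 := by
    intro z hz
    have hz1 : ‖z‖ < 1 := mem_unitDisk_iff.1 hz
    have hlim : Tendsto (fun R : ℝ => (1 / R) * (1 + (1 - R ^ 2) / (R - ‖a‖))) (𝓝[<] 1)
        (𝓝 1) := by
      have hc : ContinuousAt (fun R : ℝ => (1 / R) * (1 + (1 - R ^ 2) / (R - ‖a‖))) 1 := by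
        have : (1 : ℝ) - ‖a‖ ≠ 0 := by linarith
        fun_prop (disch := first | assumption | norm_num)
      have h := hc.tendsto
      simp only [one_pow, sub_self, zero_div, add_zero, mul_one, div_one] at h
      exact h.mono_left nhdsWithin_le_nhds
    refine ge_of_tendsto hlim ?_
    filter_upwards [Ioo_mem_nhdsLT (show max ‖a‖ ‖z‖ < 1 from max_lt ha1 hz1)] with R hR
    have haR : ‖a‖ < R := (le_max_left _ _).trans_lt hR.1
    have hzR : ‖z‖ < R := (le_max_right _ _).trans_lt hR.1
    have hR0 : 0 < R := (norm_nonneg a).trans_lt haR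
    refine Complex.norm_le_of_forall_mem_frontier_norm_le Metric.isBounded_ball
      (diffContOnCl_of_lt hgd hR0 hR.2) ?_ (subset_closure (by simpa using hzR))
    intro ζ hζ
    rw [frontier_ball _ hR0.ne', mem_sphere_zero_iff_norm] at hζ
    have hζ1 : ζ ∈ unitDisk := mem_unitDisk_iff.2 (by rw [hζ]; exact hR.2)
    have hpos : 0 < ‖ζ - a‖ := by
      have := norm_sub_norm_le ζ a
      rw [hζ] at this
      linarith
    have h1 := blaschke_circle_bound haR hR.2 hζ
    have h2 : ‖ζ - a‖ * ‖g' ζ‖ ≤ ‖1 - (starRingEnd ℂ) a * ζ‖ := by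
      have h3 : ‖a / (‖a‖ : ℂ)‖ = 1 := by
        rw [norm_div]
        simp [ha0]
      have h4 : ‖ζ - a‖ * ‖g' ζ‖ = ‖1 - (starRingEnd ℂ) a * ζ‖ * ‖g ζ‖ := by
        rw [← hds ζ, hg']
        simp only [norm_mul, h3, norm_neg]
        ring
      rw [h4]
      exact mul_le_of_le_one_right (norm_nonneg _) (hg.2 ζ hζ1)
    have h5 := h2.trans h1
    rw [mul_comm] at h5
    exact le_of_mul_le_mul_right h5 hpos
  have hgb : Bd g' := ⟨hgd, hbound⟩
  have hg'0 : g' 0 = ((x / ‖a‖ : ℝ) : ℂ) := by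
    have h := hds 0
    rw [hg0] at h
    simp only [hg']
    push_cast
    rw [← h]
    field_simp
    ring
  have hbI : blaschkeFactor a ∉ I := by
    intro hbI
    refine hno a ha ?_
    have hm : (fun z : ℂ => (1 - (starRingEnd ℂ) a * z) * (-(a / ‖a‖))) ∈ MpClass p := by
      refine mem_of_bounded hp (C := (1 + ‖a‖) * 1) (by fun_prop) ?_
      intro z hz
      rw [mem_unitDisk_iff] at hz
      have h3 : ‖a / (‖a‖ : ℂ)‖ = 1 := by
        rw [norm_div]
        simp [ha0]
      rw [norm_mul, norm_neg, h3]
      gcongr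
      refine (norm_sub_le _ _).trans ?_
      rw [norm_mul, Complex.norm_conj, norm_one]
      nlinarith [norm_nonneg a]
    refine ideal_congr hp hI hnd (hI.1.mul_mem _ hm _ hbI) ?_
    intro z hz
    have h1 := one_sub_conj_mul_ne ha hz
    simp only [Pi.mul_apply, blaschkeFactor]
    field_simp
    ring
  refine ⟨g', ?_, hgb, hg'0, _, hb, hfac⟩
  exact (prime_congr hp hI hnd (hb.mem hp) (hgb.mem hp) hgI hfac).resolve_left hbI

/-- Limits of divisor chains of bounded functions. -/
lemma chain_limit {u : ℕ → ℂ → ℂ} {x : ℕ → ℝ} (hu : ∀ n, Bd (u n)) (hx : ∀ n, 0 < x n)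
    (hux : ∀ n, u n 0 = x n)
    (hdiv : ∀ n m, n ≤ m → ∃ b, Bd b ∧ EqOn (u n) (b * u m) unitDisk) :
    ∃ (G : ℂ → ℂ) (y : ℝ), Bd G ∧ 0 < y ∧ G 0 = y ∧ Tendsto x atTop (𝓝 y) ∧
      (∀ n, ∀ z ∈ unitDisk, ‖u n z‖ ≤ ‖G z‖) := by
  have hle : ∀ n m, n ≤ m → ∀ z ∈ unitDisk, ‖u n z‖ ≤ ‖u m z‖ := by
    intro n m hnm z hz
    obtain ⟨b, hb, he⟩ := hdiv n m hnm
    rw [he hz, Pi.mul_apply, norm_mul]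
    exact mul_le_of_le_one_left (norm_nonneg _) (hb.2 z hz)
  have hnx : ∀ n, ‖u n 0‖ = x n := fun n => by
    rw [hux, Complex.norm_real, Real.norm_of_nonneg (hx n).le]
  have hmono : Monotone x := by
    intro n m hnm
    rw [← hnx, ← hnx]
    exact hle n m hnm 0 zero_mem_unitDisk
  have hbdd : BddAbove (range x) := by
    refine ⟨1, ?_⟩
    rintro _ ⟨n, rfl⟩
    rw [← hnx]
    exact (hu n).2 0 zero_mem_unitDisk
  set y := ⨆ n, x n with hy
  have hxy : Tendsto x atTop (𝓝 y) := tendsto_atTop_ciSup hmono hbdd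
  have hxle : ∀ n, x n ≤ y := fun n => le_ciSup hbdd n
  have hy0 : 0 < y := (hx 0).trans_le (hxle 0)
  have hcau : ∀ n m, n ≤ m → ∀ z ∈ unitDisk,
      ‖u m z - u n z‖ ^ 2 ≤ 8 / (1 - ‖z‖) * (1 - x n / y) := by
    intro n m hnm z hz
    obtain ⟨b, hb, he⟩ := hdiv n m hnm
    have hz1 : 0 < 1 - ‖z‖ := by
      rw [mem_unitDisk_iff] at hz
      linarith
    have h1 := hb.norm_one_sub_sq hz
    have hb0 : b 0 = ((x n / x m : ℝ) : ℂ) := by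
      have h := he zero_mem_unitDisk
      rw [Pi.mul_apply, hux, hux] at h
      have : (x m : ℂ) ≠ 0 := by exact_mod_cast (hx m).ne'
      push_cast
      rw [h]
      field_simp
    rw [hb0, Complex.ofReal_re] at h1
    have h2 : u m z - u n z = (1 - b z) * u m z := by
      rw [he hz, Pi.mul_apply]
      ring
    have h3 : x n / y ≤ x n / x m := div_le_div_of_nonneg_left (hx n).le (hx m) (hxle m)
    rw [h2, norm_mul, mul_pow]
    have h4 : ‖u m z‖ ^ 2 ≤ 1 := pow_le_one₀ (norm_nonneg _) ((hu m).2 z hz)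
    calc ‖1 - b z‖ ^ 2 * ‖u m z‖ ^ 2 ≤ ‖1 - b z‖ ^ 2 := mul_le_of_le_one_right (by positivity) h4
      _ ≤ 4 / (1 - ‖z‖) * (2 - 2 * (x n / x m)) := h1
      _ = 8 / (1 - ‖z‖) * (1 - x n / x m) := by ring
      _ ≤ _ := by gcongr
  have hrate : Tendsto (fun n => 1 - x n / y) atTop (𝓝 0) := by
    have := (hxy.div_const y).const_sub 1
    simpa [hy0.ne'] using this
  have hpt : ∀ z ∈ unitDisk, ∃ l, Tendsto (fun n => u n z) atTop (𝓝 l) := by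
    intro z hz
    apply cauchySeq_tendsto_of_complete
    refine cauchySeq_of_le_tendsto_0' (fun n => √(8 / (1 - ‖z‖) * (1 - x n / y))) ?_ ?_
    · intro n m hnm
      rw [dist_comm, dist_eq_norm]
      exact Real.le_sqrt_of_sq_le (hcau n m hnm z hz)
    · have := (Real.continuous_sqrt.tendsto 0).comp
        (by simpa using hrate.const_mul (8 / (1 - ‖z‖)) :
          Tendsto (fun n => 8 / (1 - ‖z‖) * (1 - x n / y)) atTop (𝓝 0))
      simpa [Function.comp_def] using this
  choose! G hG using hpt
  have hGn : ∀ n, ∀ z ∈ unitDisk, ‖G z - u n z‖ ^ 2 ≤ 8 / (1 - ‖z‖) * (1 - x n / y) := by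
    intro n z hz
    have h1 : Tendsto (fun m => ‖u m z - u n z‖ ^ 2) atTop (𝓝 (‖G z - u n z‖ ^ 2)) :=
      (((hG z hz).sub_const _).norm).pow 2
    refine le_of_tendsto h1 ?_
    filter_upwards [eventually_ge_atTop n] with m hm using hcau n m hm z hz
  have hloc : TendstoLocallyUniformlyOn u G atTop unitDisk := by
    rw [Metric.tendstoLocallyUniformlyOn_iff]
    intro ε hε z hz
    have hz1 : ‖z‖ < 1 := mem_unitDisk_iff.1 hz
    set ρ := (1 + ‖z‖) / 2 with hρ
    have hρ1 : ρ < 1 := by linarith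
    have hzρ : ‖z‖ < ρ := by linarith
    refine ⟨Metric.ball 0 ρ, mem_nhdsWithin_of_mem_nhds
      (Metric.isOpen_ball.mem_nhds (by simpa using hzρ)), ?_⟩
    have h1 : Tendsto (fun n => 8 / (1 - ρ) * (1 - x n / y)) atTop (𝓝 0) := by
      simpa using hrate.const_mul (8 / (1 - ρ))
    filter_upwards [h1.eventually (gt_mem_nhds (show 0 < ε ^ 2 by positivity))] with n hn w hw
    have hw' : ‖w‖ < ρ := by simpa using hw
    have h2 := hGn n w (mem_unitDisk_iff.2 (hw'.trans hρ1))
    have h3 : 0 ≤ 1 - x n / y := by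
      rw [sub_nonneg, div_le_one hy0]
      exact hxle n
    have h4 : 8 / (1 - ‖w‖) * (1 - x n / y) ≤ 8 / (1 - ρ) * (1 - x n / y) := by
      have : 0 < 1 - ρ := by linarith
      gcongr
    rw [dist_eq_norm]
    exact lt_of_pow_lt_pow_left₀ 2 hε.le ((h2.trans h4).trans_lt hn)
  refine ⟨G, y, ⟨hloc.differentiableOn (Eventually.of_forall fun n => (hu n).1) isOpen_unitDisk,
    ?_⟩, hy0, ?_, hxy, ?_⟩
  · intro z hz
    exact le_of_tendsto (hG z hz).norm (Eventually.of_forall fun n => (hu n).2 z hz)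
  · refine tendsto_nhds_unique (hG 0 zero_mem_unitDisk) ?_
    have := (Complex.continuous_ofReal.tendsto y).comp hxy
    refine this.congr fun n => ?_
    simp [hux]
  · intro n z hz
    refine ge_of_tendsto (hG z hz).norm ?_
    filter_upwards [eventually_ge_atTop n] with m hm using hle n m hm z hz

/-- Normalized bounded members of an ideal. -/
def NormMem (I : Set (ℂ → ℂ)) (g : ℂ → ℂ) : Prop :=
  g ∈ I ∧ Bd g ∧ ∃ x : ℝ, 0 < x ∧ g 0 = x

/-- Divisibility by a bounded factor. -/
def BdDvd (g g' : ℂ → ℂ) : Prop := ∃ b, Bd b ∧ EqOn g (b * g') unitDisk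

lemma BdDvd.refl (g : ℂ → ℂ) : BdDvd g g :=
  ⟨1, ⟨differentiableOn_const 1, fun z _ => by simp⟩, fun z _ => by simp⟩

lemma BdDvd.trans {f g h : ℂ → ℂ} (h1 : BdDvd f g) (h2 : BdDvd g h) : BdDvd f h := by
  obtain ⟨b, hb, he⟩ := h1
  obtain ⟨c, hc, he'⟩ := h2
  refine ⟨b * c, ⟨hb.1.mul hc.1, fun z hz => ?_⟩, fun z hz => ?_⟩
  · rw [Pi.mul_apply, norm_mul]
    exact mul_le_one₀ (hb.2 z hz) (norm_nonneg _) (hc.2 z hz)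
  · rw [he hz, Pi.mul_apply, he' hz]
    simp [mul_assoc]

lemma exists_step {I : Set (ℂ → ℂ)} {g : ℂ → ℂ} (hg : NormMem I g) {ε : ℝ} (hε : 0 < ε) :
    ∃ g', NormMem I g' ∧ BdDvd g g' ∧
      ∀ g'', NormMem I g'' → BdDvd g g'' → (g'' 0).re ≤ (g' 0).re + ε := by
  set S : Set ℝ := {y | ∃ g', NormMem I g' ∧ BdDvd g g' ∧ (g' 0).re = y} with hS
  have hb : BddAbove S := by
    refine ⟨1, ?_⟩
    rintro y ⟨g', hg', -, rfl⟩
    exact (Complex.re_le_norm _).trans (hg'.2.1.2 0 zero_mem_unitDisk)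
  have hne : S.Nonempty := ⟨_, g, hg, BdDvd.refl g, rfl⟩
  obtain ⟨y, ⟨g', hg', hd, rfl⟩, hlt⟩ := exists_lt_of_lt_csSup hne
    (show sSup S - ε < sSup S by linarith)
  refine ⟨g', hg', hd, fun g'' h1 h2 => ?_⟩
  have := le_csSup hb (show (g'' 0).re ∈ S from ⟨g'', h1, h2, rfl⟩)
  linarith

lemma exists_sub_mem {p : ℝ} (hp : 1 < p) {I : Set (ℂ → ℂ)} (hI : IsPrimeIdealIn p I)
    (hnd : ¬ IsDenseIn p I) (hnz : ∃ f ∈ I, ¬ Set.EqOn f 0 unitDisk) :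
    ∃ w ∈ unitDisk, (fun z : ℂ => z - w) ∈ I := by
  by_contra! hno
  obtain ⟨g0, hg0⟩ : ∃ g, NormMem I g := exists_normalized hp hI hnd hnz hno
  have hstep : ∀ (n : ℕ) (g : {g // NormMem I g}), ∃ g' : {g // NormMem I g},
      BdDvd g.1 g'.1 ∧ ∀ g'', NormMem I g'' → BdDvd g.1 g'' →
        (g'' 0).re ≤ (g'.1 0).re + 1 / ((n : ℝ) + 1) := by
    intro n g
    obtain ⟨g', h1, h2, h3⟩ := exists_step g.2 (ε := 1 / ((n : ℝ) + 1)) (by positivity)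
    exact ⟨⟨g', h1⟩, h2, h3⟩
  choose next hnext1 hnext2 using hstep
  let v : ℕ → {g // NormMem I g} := fun n => Nat.rec ⟨g0, hg0⟩ (fun n g => next n g) n
  have hv1 : ∀ n, BdDvd (v n).1 (v (n + 1)).1 := fun n => hnext1 n (v n)
  have hv2 : ∀ n, ∀ g'', NormMem I g'' → BdDvd (v n).1 g'' →
      (g'' 0).re ≤ ((v (n + 1)).1 0).re + 1 / ((n : ℝ) + 1) := fun n => hnext2 n (v n)
  clear_value v
  have hdv : ∀ n m, n ≤ m → BdDvd (v n).1 (v m).1 := by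
    intro n m hnm
    induction m, hnm using Nat.le_induction with
    | base => exact BdDvd.refl _
    | succ m _ ih => exact ih.trans (hv1 m)
  choose x hx0 hx using fun n => (v n).2.2.2
  obtain ⟨G, y, hGb, hy0, hG0, hxy, hGle⟩ :=
    chain_limit (u := fun n => (v n).1) (x := x) (fun n => (v n).2.2.1) hx0 hx hdv
  have hzf : ∀ z ∈ unitDisk, G z ≠ 0 := by
    intro a ha hGa
    have hva : ∀ n, (v n).1 a = 0 := by
      intro n
      have := hGle n a ha
      rw [hGa, norm_zero] at this
      exact norm_le_zero_iff.1 this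
    have hkey : ∀ n, a ≠ 0 ∧ x n / ‖a‖ ≤ x (n + 1) + 1 / ((n : ℝ) + 1) := by
      intro n
      obtain ⟨ha0, g', hg'I, hg'b, hg'0, hd⟩ :=
        blaschke_step hp hI hnd hno (v n).2.1 (v n).2.2.1 (hx0 n) (hx n) ha (hva n)
      have hpos : 0 < x n / ‖a‖ := div_pos (hx0 n) (norm_pos_iff.2 ha0)
      have h := hv2 n g' ⟨hg'I, hg'b, _, hpos, hg'0⟩ hd
      rw [hg'0, hx, Complex.ofReal_re, Complex.ofReal_re] at h
      exact ⟨ha0, h⟩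
    have ha0 := (hkey 0).1
    have hl1 : Tendsto (fun n => x n / ‖a‖) atTop (𝓝 (y / ‖a‖)) := hxy.div_const _
    have hl2 : Tendsto (fun n : ℕ => x (n + 1) + 1 / ((n : ℝ) + 1)) atTop (𝓝 (y + 0)) :=
      ((tendsto_add_atTop_iff_nat 1).2 hxy).add tendsto_one_div_add_atTop_nhds_zero_nat
    have hle := le_of_tendsto_of_tendsto' hl1 hl2 fun n => (hkey n).2
    have hapos := norm_pos_iff.2 ha0
    rw [add_zero, div_le_iff₀ hapos] at hle
    have := mem_unitDisk_iff.1 ha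
    nlinarith
  have hGI : G ∉ I := zero_free_not_mem hp hI hnd hGb hzf hy0 hG0
  refine hnd (dense_of_approx hp hI.1 fun η hη => ?_)
  have hlim : Tendsto (fun n => 2 - 2 * (x n / y)) atTop (𝓝 0) := by
    have := ((hxy.div_const y).const_mul 2).const_sub 2
    simpa [hy0.ne'] using this
  obtain ⟨n, hn⟩ := (hlim.eventually (gt_mem_nhds (show 0 < η ^ 2 by positivity))).exists
  have hkb : Bd ((v n).1 / G) := by
    refine ⟨(v n).2.2.1.1.div hGb.1 hzf, fun z hz => ?_⟩
    rw [Pi.div_apply, norm_div, div_le_one (norm_pos_iff.2 (hzf z hz))]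
    exact hGle n z hz
  refine ⟨(v n).1 / G, ?_, hkb, x n / y, ?_, hn.le⟩
  · refine (prime_congr hp hI hnd (hkb.mem hp) (hGb.mem hp) (v n).2.1 ?_).resolve_right hGI
    intro z hz
    have := hzf z hz
    simp only [Pi.mul_apply, Pi.div_apply]
    field_simp
  · rw [Pi.div_apply, hx, hG0]
    push_cast
    rfl


/-- A nonzero prime ideal of `M^p` (`1 < p < ∞`) which is not dense in
`(M^p, ρ_p)` is of the form `𝓜_λ = {f ∈ M^p : f(λ) = 0}` for some `λ` in the unit disk. -/
theorem prime_ideal_not_dense_eq_vanishing_ideal (p : ℝ) (hp : 1 < p)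
    (I : Set (ℂ → ℂ)) (hI : IsPrimeIdealIn p I)
    (hnz : ∃ f ∈ I, ¬ Set.EqOn f 0 unitDisk)
    (hnd : ¬ IsDenseIn p I) :
    ∃ w ∈ unitDisk, I = {f ∈ MpClass p | f w = 0} := by
  obtain ⟨w, hw, hwI⟩ := exists_sub_mem hp hI hnd hnz
  exact ⟨w, hw, eq_vanishing hp hI hnd hw hwI⟩
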